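/- Let N ≥ 3, J ∈ ℝ, and let λ₃, …, λ_ℓ ∈ ℂ be pairwise distinct with λ_j ∉ {i/2, −i/2, 3i/2, −3i/2} and λ_k − λ_j ≠ i for all j ≠ k, such that (i/2, −i/2, λ₃, …, λ_ℓ) satisfies the Bethe ansatz equations for k = 3, …, ℓ, and suppose c ∈ ℂ satisfies both c = −(2/i^{N+1}) ∏_{j=3}^{ℓ} (λ_j − 3i/2)/(λ_j + i/2) and c = 2 i^{N+1} ∏_{j=3}^{ℓ} (λ_j + 3i/2)/(λ_j − i/2). Then the Nepomechie–Wang state Ψ = lim_{ε→0} ε^{−N} B_N(λ₁(ε)) B_N(λ₂(ε)) B_N(λ₃) ⋯ B_N(λ_ℓ) |0⟩_N satisfies ℋ_N Ψ = ℰ Ψ with energy eigenvalue ℰ = −J − (J/2) Σ_{j=3}^{ℓ} 1/(λ_j² + 1/4). -/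

import Mathlib

open Complex Matrix Filter Topology

noncomputable section

/-- The index set of the standard basis of `𝔥_N = (ℂ²)^{⊗N}`. -/
abbrev St (N : ℕ) := Fin N → Fin 2

/-- The Pauli matrices `σ¹, σ², σ³`. -/
def pauli : Fin 3 → Matrix (Fin 2) (Fin 2) ℂ
  | 0 => !![0, 1; 1, 0]
  | 1 => !![0, -Complex.I; Complex.I, 0]
  | 2 => !![1, 0; 0, -1]

/-- The operator `σₖᵃ` on `𝔥_N`, acting as `σᵃ` on the `k`-th tensor factor
and as the identity on the others. -/
def siteOp (N : ℕ) (a : Fin 3) (k : Fin N) : Matrix (St N) (St N) ℂ :=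
  Matrix.of fun x y =>
    pauli a (x k) (y k) * ∏ j ∈ Finset.univ.erase k, (if x j = y j then (1 : ℂ) else 0)

/-- The L-operator `Lₖ(λ) = λ (I ⊗ 𝟙) + (i/2) Σₐ σᵃ ⊗ σₖᵃ` on `ℂ² ⊗ 𝔥_N`. -/
def Lop (N : ℕ) (lam : ℂ) (k : Fin N) : Matrix (Fin 2 × St N) (Fin 2 × St N) ℂ :=
  lam • (1 : Matrix (Fin 2 × St N) (Fin 2 × St N) ℂ) +
    (Complex.I / 2) • ∑ a : Fin 3,
      Matrix.of fun p q : Fin 2 × St N => pauli a p.1 q.1 * siteOp N a k p.2 q.2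

/-- The monodromy matrix `T_N(λ) = L_N(λ) L_{N-1}(λ) ⋯ L_1(λ)`. -/
def monodromy (N : ℕ) (lam : ℂ) : Matrix (Fin 2 × St N) (Fin 2 × St N) ℂ :=
  (((List.finRange N).reverse).map (Lop N lam)).prod

/-- `A_N(λ)`: the (0,0) block of `T_N(λ)` in the auxiliary space. -/
def Aop (N : ℕ) (lam : ℂ) : Matrix (St N) (St N) ℂ :=
  Matrix.of fun x y => monodromy N lam (0, x) (0, y)

/-- `B_N(λ)`: the (0,1) block of `T_N(λ)` in the auxiliary space. -/
def Bop (N : ℕ) (lam : ℂ) : Matrix (St N) (St N) ℂ :=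
  Matrix.of fun x y => monodromy N lam (0, x) (1, y)

/-- `C_N(λ)`: the (1,0) block of `T_N(λ)` in the auxiliary space. -/
def Cop (N : ℕ) (lam : ℂ) : Matrix (St N) (St N) ℂ :=
  Matrix.of fun x y => monodromy N lam (1, x) (0, y)

/-- `D_N(λ)`: the (1,1) block of `T_N(λ)` in the auxiliary space. -/
def Dop (N : ℕ) (lam : ℂ) : Matrix (St N) (St N) ℂ :=
  Matrix.of fun x y => monodromy N lam (1, x) (1, y)

/-- The transfer matrix `τ_N(λ) = A_N(λ) + D_N(λ)`. -/
def tau (N : ℕ) (lam : ℂ) : Matrix (St N) (St N) ℂ := Aop N lam + Dop N lam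

/-- The vacuum vector `|0⟩_N = v₊^{⊗N}`. -/
def vac (N : ℕ) : St N → ℂ := fun x => if x = (fun _ => (0 : Fin 2)) then 1 else 0

/-- Cyclic successor on `Fin N`, implementing periodic boundary conditions. -/
def cyc {N : ℕ} (k : Fin N) : Fin N := ⟨(k.1 + 1) % N, Nat.mod_lt _ k.pos⟩

/-- The XXX Hamiltonian
`ℋ_N = (J/4) Σₖ (σₖ¹σ_{k+1}¹ + σₖ²σ_{k+1}² + σₖ³σ_{k+1}³ − 𝟙)`. -/
def Ham (N : ℕ) (J : ℝ) : Matrix (St N) (St N) ℂ :=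
  ((J : ℂ) / 4) • ∑ k : Fin N,
    ((∑ a : Fin 3, siteOp N a k * siteOp N a (cyc k)) - 1)

/-- The product of creation operators `B_N(λ₁) ⋯ B_N(λ_ℓ)`. -/
def betheProd (N : ℕ) {l : ℕ} (lam : Fin l → ℂ) : Matrix (St N) (St N) ℂ :=
  ((List.finRange l).map fun j => Bop N (lam j)).prod

/-- The Bethe vector `B_N(λ₁) ⋯ B_N(λ_ℓ) |0⟩_N`. -/
def betheVec (N : ℕ) {l : ℕ} (lam : Fin l → ℂ) : St N → ℂ :=
  (betheProd N lam).mulVec (vac N)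

/-- The eigenvalue `Λ(λ; λ₁,…,λ_ℓ)` of the transfer matrix. -/
def Lam (N : ℕ) {l : ℕ} (lam0 : ℂ) (lam : Fin l → ℂ) : ℂ :=
  (lam0 + Complex.I / 2) ^ N * ∏ j, (lam0 - lam j - Complex.I) / (lam0 - lam j) +
    (lam0 - Complex.I / 2) ^ N * ∏ j, (lam j - lam0 - Complex.I) / (lam j - lam0)

/-- The unwanted-term coefficient `Λ_k(λ; λ₁,…,λ_ℓ)`. -/
def LamK (N : ℕ) {l : ℕ} (lam0 : ℂ) (lam : Fin l → ℂ) (k : Fin l) : ℂ :=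
  Complex.I / (lam0 - lam k) *
    ((lam k + Complex.I / 2) ^ N *
        ∏ j ∈ Finset.univ.erase k, (lam k - lam j - Complex.I) / (lam k - lam j) -
      (lam k - Complex.I / 2) ^ N *
        ∏ j ∈ Finset.univ.erase k, (lam j - lam k - Complex.I) / (lam j - lam k))

/-- The Bethe ansatz equations for the spin 1/2 XXX chain of length `N`. -/
def BetheEq (N : ℕ) {l : ℕ} (lam : Fin l → ℂ) : Prop :=
  ∀ k, ((lam k + Complex.I / 2) / (lam k - Complex.I / 2)) ^ N =
    ∏ j ∈ Finset.univ.erase k, (lam k - lam j + Complex.I) / (lam k - lam j - Complex.I)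

/-- Nepomechie–Wang regularization: `λ₁(ε) = i/2 + ε + c ε^N`. -/
def nwLam1 (N : ℕ) (c : ℂ) (eps : ℂ) : ℂ := Complex.I / 2 + eps + c * eps ^ N

/-- Nepomechie–Wang regularization: `λ₂(ε) = −i/2 + ε`. -/
def nwLam2 (eps : ℂ) : ℂ := -(Complex.I / 2) + eps

/-- The regularized tuple `(λ₁(ε), λ₂(ε), λ₃, …, λ_ℓ)`. -/
def nwTuple (N : ℕ) (c : ℂ) {m : ℕ} (mu : Fin m → ℂ) (eps : ℂ) : Fin (m + 2) → ℂ :=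
  Fin.cons (nwLam1 N c eps) (Fin.cons (nwLam2 eps) mu)

/-- The singular tuple `(i/2, −i/2, λ₃, …, λ_ℓ)`. -/
def singTuple {m : ℕ} (mu : Fin m → ℂ) : Fin (m + 2) → ℂ :=
  Fin.cons (Complex.I / 2) (Fin.cons (-(Complex.I / 2)) mu)

/-- The `2 × 2` auxiliary-space block of the L-operator between the site basis states `s`, `t`. -/
def loc (lam : ℂ) (s t : Fin 2) : Matrix (Fin 2) (Fin 2) ℂ :=
  (if s = t then lam - Complex.I / 2 else 0) • (1 : Matrix (Fin 2) (Fin 2) ℂ) +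
    Complex.I • Matrix.single t s 1

theorem pauli_completeness (a b s t : Fin 2) :
    ∑ e : Fin 3, pauli e a b * pauli e s t =
      2 * (if a = t ∧ s = b then 1 else 0) - (if a = b ∧ s = t then 1 else 0) := by
  fin_cases a <;> fin_cases b <;> fin_cases s <;> fin_cases t <;>
    simp [Fin.sum_univ_three, pauli] <;> norm_num

theorem one_prod_apply {N : ℕ} (k : Fin N) (a b : Fin 2) (x y : St N) :
    (1 : Matrix (Fin 2 × St N) (Fin 2 × St N) ℂ) (a, x) (b, y) =
      (if a = b ∧ x k = y k then 1 else 0) *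
        ∏ j ∈ Finset.univ.erase k, (if x j = y j then (1 : ℂ) else 0) := by
  simp only [Matrix.one_apply, Prod.mk.injEq, Finset.prod_ite_zero, Finset.prod_const_one,
    Finset.mem_erase, Finset.mem_univ, and_true, ← ite_and, mul_ite, mul_one, mul_zero]
  congr 1
  simp only [funext_iff, eq_iff_iff]
  grind

theorem Lop_apply {N : ℕ} (lam : ℂ) (k : Fin N) (a b : Fin 2) (x y : St N) :
    Lop N lam k (a, x) (b, y) = loc lam (x k) (y k) a b *
      ∏ j ∈ Finset.univ.erase k, (if x j = y j then (1 : ℂ) else 0) := by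
  have h := pauli_completeness a b (x k) (y k)
  simp only [Lop, Matrix.add_apply, Matrix.smul_apply, Matrix.sum_apply, Matrix.of_apply, siteOp,
    one_prod_apply k, smul_eq_mul, ← mul_assoc, ← Finset.sum_mul, h]
  rw [← add_mul]
  congr 1
  simp only [loc, Matrix.add_apply, Matrix.smul_apply, Matrix.one_apply, Matrix.single_apply,
    smul_eq_mul]
  grind

theorem prod_erase_delta {N : ℕ} (k : Fin N) (x z : St N) :
    (∏ j ∈ Finset.univ.erase k, (if x j = z j then (1 : ℂ) else 0)) =
      ∑ s : Fin 2, if z = Function.update x k s then 1 else 0 := by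
  simp only [Finset.prod_ite_zero, Finset.prod_const_one, Finset.mem_erase, Finset.mem_univ,
    and_true, Function.eq_update_iff]
  rw [Finset.sum_eq_single (z k)]
  · congr 1
    simp only [eq_iff_iff]
    grind
  · grind
  · simp

/-- The product over the sites of the local blocks between two basis states. -/
def locProd {N : ℕ} (lam : ℂ) (x y : St N) : Matrix (Fin 2) (Fin 2) ℂ :=
  ((List.finRange N).reverse.map fun k => loc lam (x k) (y k)).prod

theorem prod_Lop_apply {N : ℕ} (lam : ℂ) (l : List (Fin N)) (hl : l.Nodup) (a b : Fin 2)
    (x y : St N) :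
    (l.map (Lop N lam)).prod (a, x) (b, y) =
      (l.map fun k => loc lam (x k) (y k)).prod a b * if ∀ j ∉ l, x j = y j then 1 else 0 := by
  induction l generalizing a x with
  | nil =>
    simp only [List.map_nil, List.prod_nil, Matrix.one_apply, Prod.mk.injEq, funext_iff]
    grind
  | cons k l ih =>
    obtain ⟨hk, hl⟩ := List.nodup_cons.1 hl
    simp only [List.map_cons, List.prod_cons, Matrix.mul_apply (l := Fin 2 × St N),
      Fintype.sum_prod_type, Lop_apply, ih hl, prod_erase_delta, Finset.mul_sum, Finset.sum_mul, mul_ite,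
      mul_one, mul_zero, ite_mul, zero_mul]
    simp only [Matrix.mul_apply (l := Fin 2)]
    split_ifs with h
    · refine Finset.sum_congr rfl fun c _ => ?_
      have hx : ∀ j ∉ l, Function.update x k (y k) j = y j := by
        intro j hj
        by_cases e : j = k
        · subst e; simp
        · rw [Function.update_of_ne e]
          exact h j (by simp [e, hj])
      rw [Finset.sum_eq_single (Function.update x k (y k))]
      · rw [if_pos hx, Finset.sum_eq_single (y k)]
        · rw [if_pos rfl, Function.update_self]
          have hmap : (l.map fun j => loc lam (Function.update x k (y k) j) (y j)) =
              l.map fun j => loc lam (x j) (y j) := List.map_congr_left fun j hj => by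
            rw [Function.update_of_ne (ne_of_mem_of_not_mem hj hk)]
          rw [hmap]
        · intro s _ hs
          exact if_neg fun e => hs (by simpa using (congrFun e k).symm)
        · simp
      · intro z _ hz
        split_ifs with h1
        · refine Finset.sum_eq_zero fun s _ => if_neg fun e => hz ?_
          have hs := h1 k hk
          rw [e, Function.update_self] at hs
          rw [e, hs]
        · rfl
      · simp
    · refine Finset.sum_eq_zero fun c _ => Finset.sum_eq_zero fun z _ => ?_
      split_ifs with h1
      · refine Finset.sum_eq_zero fun s _ => if_neg fun e => h fun j hj => ?_
        rw [List.mem_cons, not_or] at hj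
        simpa [e, Function.update_of_ne hj.1] using h1 j hj.2
      · rfl

theorem monodromy_apply {N : ℕ} (lam : ℂ) (a b : Fin 2) (x y : St N) :
    monodromy N lam (a, x) (b, y) = locProd lam x y a b := by
  rw [monodromy, prod_Lop_apply lam _ (List.nodup_reverse.2 (List.nodup_finRange N)), locProd]
  simp

theorem locProd_succ {N : ℕ} (lam : ℂ) (x y : St (N + 1)) :
    locProd lam x y = locProd lam (Fin.tail x) (Fin.tail y) * loc lam (x 0) (y 0) := by
  simp [locProd, List.finRange_succ, List.map_reverse, Function.comp_def, Fin.tail]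

theorem sum_St_succ {N : ℕ} {V : Type*} [AddCommMonoid V] (f : St (N + 1) → V) :
    ∑ y, f y = ∑ y' : St N, ∑ s : Fin 2, f (Fin.cons s y') := by
  rw [← (Fin.consEquiv fun _ : Fin (N + 1) => Fin 2).sum_comp, Fintype.sum_prod_type_right]
  rfl

open scoped Kronecker in
/-- The operator-space entry of `T(lam) ⊗ T(nu)`, with `T(lam)` acting to the left of `T(nu)`. -/
def kronProd {N : ℕ} (lam nu : ℂ) (x z : St N) : Matrix (Fin 2 × Fin 2) (Fin 2 × Fin 2) ℂ :=
  ∑ y : St N, locProd lam x y ⊗ₖ locProd nu y z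

open scoped Kronecker in
/-- The operator-space entry of `T(lam) ⊗ T(nu)`, with `T(lam)` acting to the right of `T(nu)`. -/
def kronProdRev {N : ℕ} (lam nu : ℂ) (x z : St N) : Matrix (Fin 2 × Fin 2) (Fin 2 × Fin 2) ℂ :=
  ∑ y : St N, locProd lam y z ⊗ₖ locProd nu x y

open scoped Kronecker in
theorem kronProd_succ {N : ℕ} (lam nu : ℂ) (x z : St (N + 1)) :
    kronProd lam nu x z = kronProd lam nu (Fin.tail x) (Fin.tail z) *
      ∑ s : Fin 2, loc lam (x 0) s ⊗ₖ loc nu s (z 0) := by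
  simp only [kronProd, sum_St_succ, locProd_succ, Matrix.mul_kronecker_mul, Fin.tail_cons,
    Fin.cons_zero, Finset.sum_mul_sum]

open scoped Kronecker in
theorem kronProdRev_succ {N : ℕ} (lam nu : ℂ) (x z : St (N + 1)) :
    kronProdRev lam nu x z = kronProdRev lam nu (Fin.tail x) (Fin.tail z) *
      ∑ s : Fin 2, loc lam s (z 0) ⊗ₖ loc nu (x 0) s := by
  simp only [kronProdRev, sum_St_succ, locProd_succ, Matrix.mul_kronecker_mul, Fin.tail_cons,
    Fin.cons_zero, Finset.sum_mul_sum]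

/-- The flip of the two tensor factors of `ℂ² ⊗ ℂ²`. -/
def flip2 : Matrix (Fin 2 × Fin 2) (Fin 2 × Fin 2) ℂ :=
  Matrix.of fun p q => if p = q.swap then 1 else 0

/-- The rational R-matrix. -/
def Rmat (u : ℂ) : Matrix (Fin 2 × Fin 2) (Fin 2 × Fin 2) ℂ := u • 1 + Complex.I • flip2

open scoped Kronecker in
theorem local_RTT (lam nu : ℂ) (s t : Fin 2) :
    Rmat (lam - nu) * (∑ r : Fin 2, loc lam s r ⊗ₖ loc nu r t) =
      (∑ r : Fin 2, loc lam r t ⊗ₖ loc nu s r) * Rmat (lam - nu) := by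
  ext ⟨i, k⟩ ⟨j, l⟩
  fin_cases s <;> fin_cases t <;> fin_cases i <;> fin_cases k <;> fin_cases j <;> fin_cases l <;>
    simp [Rmat, flip2, loc, Matrix.mul_apply, Fintype.sum_prod_type, Fin.sum_univ_two,
      Matrix.one_apply, Matrix.single_apply] <;>
    first | ring1 | (ring_nf; simp only [Complex.I_sq]; ring1)

theorem RTT {N : ℕ} (lam nu : ℂ) (x z : St N) :
    Rmat (lam - nu) * kronProd lam nu x z = kronProdRev lam nu x z * Rmat (lam - nu) := by
  induction N with
  | zero =>
    simp [kronProd, kronProdRev, locProd]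
  | succ N ih =>
    rw [kronProd_succ, kronProdRev_succ, ← mul_assoc, ih, mul_assoc, local_RTT, mul_assoc]

theorem flip2_mul (M : Matrix (Fin 2 × Fin 2) (Fin 2 × Fin 2) ℂ) :
    flip2 * M = M.submatrix Prod.swap id := by
  ext p q
  rw [Matrix.mul_apply, Finset.sum_eq_single p.swap]
  · simp [flip2]
  · intro r _ hr
    rw [flip2, Matrix.of_apply, if_neg, zero_mul]
    rintro rfl
    exact hr (Prod.swap_swap r).symm
  · simp

theorem mul_flip2 (M : Matrix (Fin 2 × Fin 2) (Fin 2 × Fin 2) ℂ) :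
    M * flip2 = M.submatrix id Prod.swap := by
  ext p q
  simp [flip2, Matrix.mul_apply]

theorem RTT_apply {N : ℕ} (lam nu : ℂ) (x z : St N) (i j k l : Fin 2) :
    (lam - nu) * kronProd lam nu x z (i, k) (j, l) + Complex.I * kronProd lam nu x z (k, i) (j, l) =
      (lam - nu) * kronProdRev lam nu x z (i, k) (j, l) +
        Complex.I * kronProdRev lam nu x z (i, k) (l, j) := by
  have h := congrFun (congrFun (RTT lam nu x z) (i, k)) (j, l)
  simpa [Rmat, add_mul, mul_add, flip2_mul, mul_flip2] using h

theorem kronProd_apply {N : ℕ} (lam nu : ℂ) (x z : St N) (i j k l : Fin 2) :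
    kronProd lam nu x z (i, k) (j, l) =
      ∑ y, monodromy N lam (i, x) (j, y) * monodromy N nu (k, y) (l, z) := by
  simp [kronProd, Matrix.sum_apply, Matrix.kroneckerMap_apply, monodromy_apply]

theorem kronProdRev_apply {N : ℕ} (lam nu : ℂ) (x z : St N) (i j k l : Fin 2) :
    kronProdRev lam nu x z (i, k) (j, l) =
      ∑ y, monodromy N nu (k, x) (l, y) * monodromy N lam (i, y) (j, z) := by
  simp [kronProdRev, Matrix.sum_apply, Matrix.kroneckerMap_apply, monodromy_apply, mul_comm]

theorem B_mul_B {N : ℕ} (lam nu : ℂ) : Bop N lam * Bop N nu = Bop N nu * Bop N lam := by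
  have key : ∀ lam nu : ℂ, lam - nu + Complex.I ≠ 0 →
      Bop N lam * Bop N nu = Bop N nu * Bop N lam := by
    intro lam nu h
    ext x z
    have := RTT_apply lam nu x z 0 1 0 1
    simp only [kronProd_apply, kronProdRev_apply] at this
    simp only [Matrix.mul_apply, Bop, Matrix.of_apply]
    refine mul_left_cancel₀ h ?_
    linear_combination this
  by_cases h : lam - nu + Complex.I = 0
  · refine (key nu lam fun h' => ?_).symm
    exact Complex.I_ne_zero (by linear_combination (h + h') / 2)
  · exact key lam nu h

theorem A_mul_B {N : ℕ} (lam nu : ℂ) :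
    (lam - nu) • (Aop N lam * Bop N nu) =
      (lam - nu - Complex.I) • (Bop N nu * Aop N lam) + Complex.I • (Bop N lam * Aop N nu) := by
  ext x z
  have := RTT_apply nu lam x z 0 1 0 0
  simp only [kronProd_apply, kronProdRev_apply] at this
  simp only [Matrix.add_apply, Matrix.smul_apply, smul_eq_mul, Matrix.mul_apply, Aop, Bop,
    Matrix.of_apply]
  linear_combination this

theorem D_mul_B {N : ℕ} (lam nu : ℂ) :
    (lam - nu) • (Dop N lam * Bop N nu) =
      (lam - nu + Complex.I) • (Bop N nu * Dop N lam) - Complex.I • (Bop N lam * Dop N nu) := by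
  ext x z
  have := RTT_apply lam nu x z 1 1 0 1
  simp only [kronProd_apply, kronProdRev_apply] at this
  simp only [Matrix.sub_apply, Matrix.smul_apply, smul_eq_mul, Matrix.mul_apply, Dop, Bop,
    Matrix.of_apply]
  linear_combination this

theorem locProd_vac {N : ℕ} (lam : ℂ) (x : St N) :
    locProd lam x (fun _ => 0) 1 0 = 0 ∧
      locProd lam x (fun _ => 0) 0 0 = (lam + Complex.I / 2) ^ N * vac N x ∧
      locProd lam x (fun _ => 0) 1 1 = (lam - Complex.I / 2) ^ N * vac N x := by
  induction N with
  | zero => simp [locProd, vac, Subsingleton.elim x (fun _ => 0)]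
  | succ N ih =>
    obtain ⟨h1, h2, h3⟩ := ih (Fin.tail x)
    have ht : (Fin.tail fun _ : Fin (N + 1) => (0 : Fin 2)) = fun _ => 0 := rfl
    have hv : vac (N + 1) x = vac N (Fin.tail x) * if x 0 = 0 then 1 else 0 := by
      simp [vac, funext_iff, Fin.forall_fin_succ, Fin.tail, ← ite_and]
    rw [locProd_succ, ht, hv]
    simp only [Matrix.mul_apply, Fin.sum_univ_two, h1, h2, h3]
    have h0 : x 0 = 0 ∨ x 0 = 1 := by omega
    rcases h0 with h0 | h0 <;> rw [h0]
    · simp only [loc, Matrix.add_apply, Matrix.smul_apply, Matrix.one_apply, Matrix.single_apply,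
        smul_eq_mul]
      norm_num
      constructor <;> ring
    · simp [loc]

theorem mulVec_vac {N : ℕ} (M : Matrix (St N) (St N) ℂ) (x : St N) :
    M.mulVec (vac N) x = M x fun _ => 0 := by
  simp [Matrix.mulVec, dotProduct, vac]

theorem A_vac {N : ℕ} (lam : ℂ) :
    (Aop N lam).mulVec (vac N) = (lam + Complex.I / 2) ^ N • vac N := by
  ext x
  simp [mulVec_vac, Aop, monodromy_apply, (locProd_vac lam x).2.1]

theorem D_vac {N : ℕ} (lam : ℂ) :
    (Dop N lam).mulVec (vac N) = (lam - Complex.I / 2) ^ N • vac N := by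
  ext x
  simp [mulVec_vac, Dop, monodromy_apply, (locProd_vac lam x).2.2]

open scoped Kronecker in
/-- The fused local block, acting on the symmetric part of `ℂ² ⊗ ℂ²`. -/
def fusedLoc (u : ℂ) (s t : Fin 2) : Matrix (Fin 2 × Fin 2) (Fin 2 × Fin 2) ℂ :=
  (1 + flip2) * ((if s = t then u - Complex.I else 0) • 1 +
    Complex.I • (1 ⊗ₖ Matrix.single t s 1 + Matrix.single t s 1 ⊗ₖ 1))

open scoped Kronecker in
theorem local_fusion (u : ℂ) (s t : Fin 2) :
    (1 + flip2) *
        ∑ r : Fin 2, loc (Complex.I / 2 + u) s r ⊗ₖ loc (-(Complex.I / 2) + u) r t =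
      u • fusedLoc u s t := by
  rw [fusedLoc, add_mul, add_mul, one_mul, one_mul, flip2_mul, flip2_mul]
  ext ⟨i, k⟩ ⟨j, l⟩
  fin_cases s <;> fin_cases t <;> fin_cases i <;> fin_cases k <;> fin_cases j <;> fin_cases l <;>
    simp [loc, Fin.sum_univ_two] <;>
    first | ring1 | (left; ring1) | (ring_nf; simp only [Complex.I_sq]; ring1)

theorem flip2_mul_flip2 : flip2 * flip2 = 1 := by
  rw [flip2_mul]
  ext p q
  simp [flip2, Matrix.one_apply]

open scoped Kronecker in
theorem fusedLoc_mul (u : ℂ) (s t : Fin 2) :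
    fusedLoc u s t * (1 + flip2) = (2 : ℂ) • fusedLoc u s t := by
  have hS : (1 + flip2) * (1 + flip2) = (2 : ℂ) • (1 + flip2) := by
    rw [mul_add, add_mul, add_mul, flip2_mul_flip2, two_smul]
    simp [add_comm]
  have hK : Commute flip2 ((1 : Matrix (Fin 2) (Fin 2) ℂ) ⊗ₖ Matrix.single t s (1 : ℂ) +
      Matrix.single t s (1 : ℂ) ⊗ₖ 1) := by
    rw [Commute, SemiconjBy, flip2_mul, mul_flip2]
    ext ⟨i, k⟩ ⟨j, l⟩
    simp only [Matrix.submatrix_apply, Matrix.add_apply, Matrix.kroneckerMap_apply, Prod.swap, id]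
    ring
  have hG : Commute (1 + flip2) ((if s = t then u - Complex.I else 0) • 1 +
      Complex.I • ((1 : Matrix (Fin 2) (Fin 2) ℂ) ⊗ₖ Matrix.single t s (1 : ℂ) +
        Matrix.single t s (1 : ℂ) ⊗ₖ 1)) :=
    (Commute.one_left _).add_left
      (((Commute.one_right _).smul_right _).add_right (hK.smul_right _))
  rw [fusedLoc, mul_assoc, ← hG.eq, ← mul_assoc, hS, smul_mul_assoc]

theorem continuous_fusedLoc (s t : Fin 2) : Continuous fun u => fusedLoc u s t := by
  unfold fusedLoc
  refine continuous_const.matrix_mul (Continuous.add (Continuous.fun_smul ?_ continuous_const)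
    continuous_const)
  split_ifs <;> fun_prop

theorem fusion {N : ℕ} (x z : St N) :
    ∃ Y : ℂ → Matrix (Fin 2 × Fin 2) (Fin 2 × Fin 2) ℂ, Continuous Y ∧
      (∀ u, Y u * (1 + flip2) = (2 : ℂ) • Y u) ∧
      ∀ u, (1 + flip2) * kronProd (Complex.I / 2 + u) (-(Complex.I / 2) + u) x z =
        u ^ N • Y u := by
  induction N with
  | zero =>
    refine ⟨fun _ => 1 + flip2, continuous_const, fun u => ?_, fun u => ?_⟩
    · rw [mul_add, add_mul, add_mul, flip2_mul_flip2, two_smul]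
      simp [add_comm]
    · simp [kronProd, locProd]
  | succ N ih =>
    obtain ⟨Y, hc, hs, hY⟩ := ih (Fin.tail x) (Fin.tail z)
    refine ⟨fun u => (1 / 2 : ℂ) • (Y u * fusedLoc u (x 0) (z 0)), ?_, fun u => ?_, fun u => ?_⟩
    · exact Continuous.const_smul (hc.matrix_mul (continuous_fusedLoc _ _)) (1 / 2 : ℂ)
    · rw [smul_mul_assoc, mul_assoc, fusedLoc_mul, mul_smul_comm, smul_comm]
    · have h2 : Y u = (1 / 2 : ℂ) • (Y u * (1 + flip2)) := by
        rw [hs, smul_smul]; norm_num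
      rw [kronProd_succ, ← mul_assoc, hY, h2, smul_mul_assoc, smul_mul_assoc, mul_assoc,
        local_fusion, mul_smul_comm]
      simp only [smul_smul]
      congr 1
      ring

theorem exists_B_mul_B_eq (N : ℕ) :
    ∃ F : ℂ → Matrix (St N) (St N) ℂ, Continuous F ∧
      ∀ u, Bop N (Complex.I / 2 + u) * Bop N (-(Complex.I / 2) + u) = u ^ N • F u := by
  choose Y hc _ hY using fusion (N := N)
  refine ⟨fun u => Matrix.of fun x z => (1 / 2 : ℂ) * Y x z u (0, 0) (1, 1), ?_, fun u => ?_⟩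
  · refine continuous_matrix fun x z => continuous_const.mul ?_
    exact (hc x z).matrix_elem _ _
  · ext x z
    have h := congrFun (congrFun (hY x z u) (0, 0)) (1, 1)
    have h1 : ((1 + flip2) * kronProd (Complex.I / 2 + u) (-(Complex.I / 2) + u) x z)
        (0, 0) (1, 1) = 2 * kronProd (Complex.I / 2 + u) (-(Complex.I / 2) + u) x z
        (0, 0) (1, 1) := by
      simp [add_mul, flip2_mul]
      ring
    rw [h1, kronProd_apply, Matrix.smul_apply, smul_eq_mul] at h
    simp only [Matrix.mul_apply, Bop, Matrix.of_apply, Matrix.smul_apply, smul_eq_mul]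
    linear_combination h / 2

theorem off_shell {V ι : Type*} [AddCommGroup V] [Module ℂ V] [DecidableEq ι] (η : ℂ)
    (A B : ℂ → V →ₗ[ℂ] V)
    (hAB : ∀ lam nu v, lam ≠ nu → A lam (B nu v) =
      ((lam - nu - η) / (lam - nu)) • B nu (A lam v) + (η / (lam - nu)) • B lam (A nu v))
    (hBB : ∀ lam nu v, B lam (B nu v) = B nu (B lam v))
    (lam : ι → ℂ) (hinj : Function.Injective lam) (ψ : Finset ι → V) (a : ℂ → ℂ)
    (h0 : ∀ nu, A nu (ψ ∅) = a nu • ψ ∅)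
    (hψ : ∀ k s, k ∉ s → ψ (insert k s) = B (lam k) (ψ s)) (s : Finset ι) (nu : ℂ)
    (hnu : ∀ j ∈ s, nu ≠ lam j) :
    A nu (ψ s) = (a nu * ∏ j ∈ s, (nu - lam j - η) / (nu - lam j)) • ψ s +
      ∑ k ∈ s, (η / (nu - lam k) * (a (lam k) *
        ∏ j ∈ s.erase k, (lam k - lam j - η) / (lam k - lam j))) • B nu (ψ (s.erase k)) := by
  induction s using Finset.induction_on generalizing nu with
  | empty => simp [h0]
  | insert n s hn ih =>
    have hnn : nu ≠ lam n := hnu n (Finset.mem_insert_self n s)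
    have hns : ∀ j ∈ s, lam n ≠ lam j := fun j hj e => hn (hinj e ▸ hj)
    rw [hψ n s hn, hAB _ _ _ hnn, ih nu fun j hj => hnu j (Finset.mem_insert_of_mem hj),
      ih (lam n) hns, Finset.sum_insert hn, Finset.prod_insert hn, Finset.erase_insert hn]
    simp only [map_add, map_smul, map_sum, smul_add, Finset.smul_sum, smul_smul]
    have hsum : ∀ k ∈ s,
        (η / (nu - lam k) * (a (lam k) * ∏ j ∈ (insert n s).erase k,
          (lam k - lam j - η) / (lam k - lam j))) • B nu (ψ ((insert n s).erase k)) =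
        (((nu - lam n - η) / (nu - lam n)) * (η / (nu - lam k) * (a (lam k) *
          ∏ j ∈ s.erase k, (lam k - lam j - η) / (lam k - lam j)))) •
            B (lam n) (B nu (ψ (s.erase k))) +
        ((η / (nu - lam n)) * (η / (lam n - lam k) * (a (lam k) *
          ∏ j ∈ s.erase k, (lam k - lam j - η) / (lam k - lam j)))) •
            B nu (B (lam n) (ψ (s.erase k))) := by
      intro k hk
      have hnk : n ≠ k := fun e => hn (e ▸ hk)
      have hn' : n ∉ s.erase k := fun h => hn (Finset.mem_of_mem_erase h)
      have e1 : nu - lam n ≠ 0 := sub_ne_zero.2 hnn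
      have e2 : nu - lam k ≠ 0 := sub_ne_zero.2 (hnu k (Finset.mem_insert_of_mem hk))
      have e3 : lam k - lam n ≠ 0 := sub_ne_zero.2 (hns k hk).symm
      have e4 : lam n - lam k ≠ 0 := sub_ne_zero.2 (hns k hk)
      rw [Finset.erase_insert_of_ne hnk, Finset.prod_insert hn', hψ n _ hn',
        hBB (lam n) nu, ← add_smul]
      congr 1
      have e5 : η / (nu - lam k) * ((lam k - lam n - η) / (lam k - lam n)) =
          (nu - lam n - η) / (nu - lam n) * (η / (nu - lam k)) +
            η / (nu - lam n) * (η / (lam n - lam k)) := by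
        rw [← neg_sub (lam n) (lam k)] at e3 ⊢
        field_simp
        ring
      linear_combination (a (lam k) *
        ∏ j ∈ s.erase k, (lam k - lam j - η) / (lam k - lam j)) * e5
    rw [Finset.sum_congr rfl hsum, Finset.sum_add_distrib]
    module

theorem siteOp_mulVec {N : ℕ} (e : Fin 3) (k : Fin N) (f : St N → ℂ) (x : St N) :
    (siteOp N e k).mulVec f x = ∑ s, pauli e (x k) s * f (Function.update x k s) := by
  simp only [Matrix.mulVec, dotProduct, siteOp, Matrix.of_apply, prod_erase_delta,
    Finset.mul_sum, Finset.sum_mul, mul_ite, mul_one, mul_zero, ite_mul, zero_mul]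
  rw [Finset.sum_comm]
  simp

theorem sum_siteOp_mul_siteOp_mulVec {N : ℕ} (k k' : Fin N) (hk : k ≠ k') (f : St N → ℂ)
    (x : St N) :
    (∑ e : Fin 3, siteOp N e k * siteOp N e k').mulVec f x =
      2 * f (x ∘ Equiv.swap k k') - f x := by
  have h1 : Function.update (Function.update x k (x k')) k' (x k) = x ∘ Equiv.swap k k' := by
    rw [Equiv.swap_comm, Equiv.comp_swap_eq_update]
  simp only [Matrix.sum_mulVec, Finset.sum_apply, ← Matrix.mulVec_mulVec, siteOp_mulVec,
    Function.update_of_ne hk.symm, Finset.mul_sum, ← mul_assoc]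
  rw [Finset.sum_comm]
  conv_lhs => enter [2, s]; rw [Finset.sum_comm]
  simp only [← Finset.sum_mul, pauli_completeness, sub_mul, Finset.sum_sub_distrib]
  congr 1
  · rw [Finset.sum_eq_single (x k'), Finset.sum_eq_single (x k), h1]
    · simp
    · intro t _ ht; simp [ht.symm]
    · simp
    · intro s _ hs; simp [hs.symm]
    · simp
  · rw [Finset.sum_eq_single (x k), Finset.sum_eq_single (x k')]
    · simp
    · intro t _ ht; simp [ht.symm]
    · simp
    · intro s _ hs; simp [hs.symm]
    · simp

theorem ne_cyc {N : ℕ} (hN : 2 ≤ N) (k : Fin N) : k ≠ cyc k := by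
  intro h
  have h' : k.1 = (k.1 + 1) % N := congrArg Fin.val h
  rcases Nat.lt_or_ge (k.1 + 1) N with h1 | h1
  · rw [Nat.mod_eq_of_lt h1] at h'
    omega
  · have : k.1 + 1 = N := by omega
    rw [this, Nat.mod_self] at h'
    omega

theorem Ham_mulVec {N : ℕ} (hN : 2 ≤ N) (J : ℝ) (f : St N → ℂ) (x : St N) :
    (Ham N J).mulVec f x =
      (J : ℂ) / 2 * (∑ k : Fin N, f (x ∘ Equiv.swap k (cyc k)) - N * f x) := by
  have h : ∀ k : Fin N, ((∑ e : Fin 3, siteOp N e k * siteOp N e (cyc k)) - 1).mulVec f x =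
      2 * f (x ∘ Equiv.swap k (cyc k)) - 2 * f x := by
    intro k
    rw [Matrix.sub_mulVec, Pi.sub_apply, sum_siteOp_mul_siteOp_mulVec _ _ (ne_cyc hN k),
      Matrix.one_mulVec]
    ring
  simp only [Ham, Matrix.smul_mulVec, Pi.smul_apply, Matrix.sum_mulVec, Finset.sum_apply, h]
  simp only [Finset.sum_sub_distrib, ← Finset.mul_sum, Finset.sum_const, Finset.card_univ,
    Fintype.card_fin, nsmul_eq_mul, smul_eq_mul]
  ring

/-- The trace of the product of the matrices `M (N - 1), …, M 0`. -/
def trProd {N : ℕ} (M : Fin N → Matrix (Fin 2) (Fin 2) ℂ) : ℂ :=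
  ((List.finRange N).reverse.map M).prod.trace

theorem trProd_rotate_one {n : ℕ} (M : Fin (n + 1) → Matrix (Fin 2) (Fin 2) ℂ) :
    trProd (fun j => M (j + 1)) = trProd M := by
  have h1 : ((List.finRange (n + 1)).reverse.map fun j => M (j + 1)).prod =
      M 0 * ((List.finRange n).reverse.map fun j => M j.succ).prod := by
    rw [List.finRange_succ_last]
    simp [List.map_reverse, Function.comp_def]
  have h2 : ((List.finRange (n + 1)).reverse.map M).prod =
      ((List.finRange n).reverse.map fun j => M j.succ).prod * M 0 := by
    rw [List.finRange_succ]
    simp [List.map_reverse, Function.comp_def]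
  rw [trProd, trProd, h1, h2, Matrix.trace_mul_comm]

theorem trProd_rotate {n : ℕ} (M : Fin (n + 1) → Matrix (Fin 2) (Fin 2) ℂ) (k : Fin (n + 1)) :
    trProd (fun j => M (j + k)) = trProd M := by
  induction k using Fin.induction with
  | zero => simp
  | succ k ih =>
    rw [← ih, ← trProd_rotate_one fun j => M (j + k.castSucc)]
    congr 1
    ext1 j
    rw [← Fin.coeSucc_eq_succ, add_right_comm, add_assoc]

theorem trProd_update_zero {n : ℕ} (x y : St (n + 2)) :
    trProd (Function.update (fun j => loc (Complex.I / 2) (x j) (y j)) 0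
      ((if x 0 = y 0 then (1 : ℂ) else 0) • 1)) =
    -Complex.I * trProd fun j => loc (Complex.I / 2) (x (Equiv.swap 0 1 j)) (y j) := by
  have hloc : ∀ s t, loc (Complex.I / 2) s t = Complex.I • Matrix.single t s 1 := by
    intro s t; simp [loc]
  have hsplit : ∀ M : Fin (n + 2) → Matrix (Fin 2) (Fin 2) ℂ,
      ((List.finRange (n + 2)).reverse.map M).prod =
        ((List.finRange n).reverse.map fun j => M j.succ.succ).prod * (M 1 * M 0) := by
    intro M
    rw [List.finRange_succ, List.finRange_succ]
    simp [List.map_reverse, Function.comp_def]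
  have hs : ∀ j : Fin n, Equiv.swap (0 : Fin (n + 2)) 1 j.succ.succ = j.succ.succ := by
    intro j
    refine Equiv.swap_apply_of_ne_of_ne (Fin.succ_ne_zero _) fun h => ?_
    rw [← Fin.succ_zero_eq_one] at h
    exact Fin.succ_ne_zero _ (Fin.succ_injective _ h)
  have hu : ∀ (E : Fin (n + 2) → Matrix (Fin 2) (Fin 2) ℂ) (v : Matrix (Fin 2) (Fin 2) ℂ)
      (j : Fin n), Function.update E 0 v j.succ.succ = E j.succ.succ := fun E v j =>
    Function.update_of_ne (Fin.succ_ne_zero _) _ _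
  have hlast : loc (Complex.I / 2) (x 1) (y 1) * ((if x 0 = y 0 then (1 : ℂ) else 0) • 1) =
      (-Complex.I) • (loc (Complex.I / 2) (x 0) (y 1) * loc (Complex.I / 2) (x 1) (y 0)) := by
    simp only [hloc, smul_mul_assoc, mul_smul_comm, mul_one]
    split_ifs with h
    · rw [h, Matrix.single_mul_single_same, smul_smul, smul_smul, smul_smul]
      simp
    · rw [Matrix.single_mul_single_of_ne _ _ _ _ h]
      simp
  rw [trProd, trProd, hsplit, hsplit, ← smul_eq_mul (-Complex.I), ← Matrix.trace_smul, ← mul_smul_comm]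
  simp only [hu, hs, Equiv.swap_apply_left, Equiv.swap_apply_right, Function.update_self]
  rw [Function.update_of_ne (by simp), hlast]

theorem trProd_update {N : ℕ} (hN : 2 ≤ N) (x y : St N) (k : Fin N) :
    trProd (Function.update (fun j => loc (Complex.I / 2) (x j) (y j)) k
      ((if x k = y k then (1 : ℂ) else 0) • 1)) =
    -Complex.I * trProd fun j => loc (Complex.I / 2) ((x ∘ Equiv.swap k (cyc k)) j) (y j) := by
  obtain ⟨n, rfl⟩ := Nat.exists_eq_add_of_le' hN
  have hcyc : cyc k = 1 + k := by
    ext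
    simp [cyc, Fin.val_add, add_comm]
  have h := trProd_update_zero (fun j => x (j + k)) (fun j => y (j + k))
  rw [← trProd_rotate _ k, ← trProd_rotate (fun j => loc _ ((x ∘ _) j) (y j)) k]
  convert h using 2
  · refine funext fun j => ?_
    by_cases hj : j = 0
    · simp [hj]
    · rw [Function.update_of_ne hj, Function.update_of_ne (by simpa using hj)]
  · refine congrArg trProd (funext fun j => ?_)
    have hsw : Equiv.swap k (1 + k) (j + k) = Equiv.swap 0 1 j + k := by
      simp only [Equiv.swap_apply_def]
      have h0 : j + k = k ↔ j = 0 := by simp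
      have h1 : j + k = 1 + k ↔ j = 1 := by simp
      simp only [h0, h1]
      split_ifs <;> simp
    rw [Function.comp_apply, hcyc, hsw]

theorem hasDerivAt_prod {N : ℕ} (E G : Fin N → Matrix (Fin 2) (Fin 2) ℂ) (z : ℂ) (a b : Fin 2) :
    HasDerivAt (fun w : ℂ => ((List.finRange N).reverse.map fun k => E k + (w - z) • G k).prod a b)
      (∑ k, ((List.finRange N).reverse.map (Function.update E k (G k))).prod a b) z := by
  induction N generalizing a b with
  | zero => simpa using hasDerivAt_const z _
  | succ N ih =>
    have hsplit : ∀ M : Fin (N + 1) → Matrix (Fin 2) (Fin 2) ℂ,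
        ((List.finRange (N + 1)).reverse.map M).prod a b =
          ∑ c, ((List.finRange N).reverse.map fun j => M j.succ).prod a c * M 0 c b := by
      intro M
      rw [← Matrix.mul_apply, List.finRange_succ]
      simp [List.map_reverse, Function.comp_def]
    have hu : ∀ k : Fin N, (fun j : Fin N => Function.update E k.succ (G k.succ) j.succ) =
        Function.update (fun j => E j.succ) k (G k.succ) := by
      intro k
      ext1 j
      by_cases hj : j = k
      · simp [hj]
      · rw [Function.update_of_ne hj, Function.update_of_ne (by simpa using hj)]
    simp only [hsplit, Fin.sum_univ_succ (n := N), hu]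
    rw [Finset.sum_comm, ← Finset.sum_add_distrib]
    refine HasDerivAt.fun_sum fun c _ => ?_
    have h1 := ih (fun j => E j.succ) (fun j => G j.succ) a c
    have h2 : HasDerivAt (fun w : ℂ => (E 0 + (w - z) • G 0) c b) (G 0 c b) z := by
      simpa using (((hasDerivAt_id z).sub_const z).mul_const (G 0 c b)).const_add (E 0 c b)
    refine (h1.fun_mul h2).congr_deriv ?_
    have h0 : ∀ k : Fin N, Function.update E k.succ (G k.succ) 0 = E 0 := fun k =>
      Function.update_of_ne (Fin.succ_ne_zero k).symm _ _
    have h3 : ∀ j : Fin N, Function.update E 0 (G 0) j.succ = E j.succ := fun j =>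
      Function.update_of_ne (Fin.succ_ne_zero j) _ _
    simp only [h0, h3, Function.update_self, sub_self, zero_smul, add_zero, Finset.sum_mul]
    exact add_comm _ _

theorem loc_eq_add (z lam : ℂ) (s t : Fin 2) :
    loc lam s t = loc z s t + (lam - z) • ((if s = t then (1 : ℂ) else 0) • 1) := by
  simp only [loc]
  split_ifs <;> module

theorem tau_apply {N : ℕ} (lam : ℂ) (x y : St N) :
    tau N lam x y = trProd fun k => loc lam (x k) (y k) := by
  simp [tau, Aop, Dop, monodromy_apply, trProd, locProd, Matrix.trace, Fin.sum_univ_two]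

theorem hasDerivAt_tau {N : ℕ} (hN : 2 ≤ N) (x y : St N) :
    HasDerivAt (fun lam => tau N lam x y)
      (-Complex.I * ∑ k : Fin N, tau N (Complex.I / 2) (x ∘ Equiv.swap k (cyc k)) y)
      (Complex.I / 2) := by
  simp only [tau_apply, Finset.mul_sum, ← trProd_update hN]
  conv => enter [1, lam, 1, k]; rw [loc_eq_add (Complex.I / 2)]
  simp only [trProd, Matrix.trace, Matrix.diag, Fin.sum_univ_two, Finset.sum_add_distrib]
  exact (hasDerivAt_prod _ _ _ 0 0).add (hasDerivAt_prod _ _ _ 1 1)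

theorem hasDerivAt_tau_mulVec {N : ℕ} (hN : 2 ≤ N) (f : St N → ℂ) (x : St N) :
    HasDerivAt (fun lam => (tau N lam).mulVec f x)
      (-Complex.I * ∑ k : Fin N,
        (tau N (Complex.I / 2)).mulVec f (x ∘ Equiv.swap k (cyc k))) (Complex.I / 2) := by
  simp only [Matrix.mulVec, dotProduct]
  rw [Finset.sum_comm, Finset.mul_sum]
  refine HasDerivAt.fun_sum fun y _ => ?_
  rw [← Finset.sum_mul, ← mul_assoc]
  exact (hasDerivAt_tau hN x y).mul_const _

/-- The Hamiltonian is the logarithmic derivative of the transfer matrix at `I / 2`. -/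
theorem Ham_mulVec_eq_of_tau {N : ℕ} (hN : 2 ≤ N) (J : ℝ) (f : St N → ℂ) (L : ℂ → ℂ) (r : ℂ)
    (h : ∀ᶠ lam in 𝓝[≠] (Complex.I / 2), (tau N lam).mulVec f = L lam • f)
    (h0 : L (Complex.I / 2) ≠ 0)
    (hL : HasDerivAt L (L (Complex.I / 2) * r) (Complex.I / 2)) :
    (Ham N J).mulVec f = ((J : ℂ) / 2 * (Complex.I * r - N)) • f := by
  have hd : ∀ x, HasDerivAt (fun lam => L lam * f x) (L (Complex.I / 2) * r * f x)
      (Complex.I / 2) := fun x => hL.mul_const _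
  have heq : ∀ x, (fun lam => (tau N lam).mulVec f x) =ᶠ[𝓝 (Complex.I / 2)]
      fun lam => L lam * f x := by
    intro x
    rw [← ContinuousAt.eventuallyEq_nhds_iff_eventuallyEq_nhdsNE
      (hasDerivAt_tau_mulVec hN f x).continuousAt (hd x).continuousAt]
    filter_upwards [h] with lam hlam
    rw [hlam, Pi.smul_apply, smul_eq_mul]
  ext x
  have h2 := (hasDerivAt_tau_mulVec hN f x).unique ((hd x).congr_of_eventuallyEq (heq x))
  simp only [(heq _).eq_of_nhds, ← Finset.mul_sum] at h2
  have h3 : ∑ k : Fin N, f (x ∘ Equiv.swap k (cyc k)) = Complex.I * r * f x := by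
    refine mul_left_cancel₀ h0 ?_
    linear_combination Complex.I * h2 + L (Complex.I / 2) *
      (∑ k : Fin N, f (x ∘ Equiv.swap k (cyc k))) * Complex.I_sq
  rw [Ham_mulVec hN, h3, Pi.smul_apply, smul_eq_mul]
  ring

theorem pairwise_commute_Bop (N : ℕ) {ι : Type*} (lam : ι → ℂ) (s : Set ι) :
    s.Pairwise (Function.onFun Commute fun j => Bop N (lam j)) :=
  fun _ _ _ _ _ => B_mul_B _ _

/-- The product of the `B_N(λⱼ)`, `j ∈ s`, applied to the vacuum vector. -/
def partialVec (N : ℕ) {ι : Type*} (lam : ι → ℂ) (s : Finset ι) : St N → ℂ :=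
  (s.noncommProd (fun j => Bop N (lam j)) (pairwise_commute_Bop N lam s)).mulVec (vac N)

theorem partialVec_empty (N : ℕ) {ι : Type*} (lam : ι → ℂ) : partialVec N lam ∅ = vac N := by
  simp [partialVec]

theorem partialVec_insert (N : ℕ) {ι : Type*} [DecidableEq ι] (lam : ι → ℂ) (k : ι)
    (s : Finset ι) (hk : k ∉ s) :
    partialVec N lam (insert k s) = (Bop N (lam k)).mulVec (partialVec N lam s) := by
  rw [partialVec, Finset.noncommProd_insert_of_notMem _ _ _ _ hk, partialVec, Matrix.mulVec_mulVec]

theorem partialVec_univ (N : ℕ) {l : ℕ} (lam : Fin l → ℂ) :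
    partialVec N lam Finset.univ = betheVec N lam := by
  rw [partialVec, betheVec, betheProd]
  congr 1
  exact Multiset.noncommProd_coe _ _

theorem tau_mulVec_partialVec (N : ℕ) {l : ℕ} (lam : Fin l → ℂ) (hinj : Function.Injective lam)
    (nu : ℂ) (hnu : ∀ j, nu ≠ lam j) :
    (tau N nu).mulVec (partialVec N lam Finset.univ) =
      Lam N nu lam • partialVec N lam Finset.univ +
        ∑ k, LamK N nu lam k • (Bop N nu).mulVec (partialVec N lam (Finset.univ.erase k)) := by
  have hBB : ∀ lam nu v, (Bop N lam).mulVecLin ((Bop N nu).mulVecLin v) =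
      (Bop N nu).mulVecLin ((Bop N lam).mulVecLin v) := by
    intro lam nu v
    simp only [Matrix.mulVecLin_apply, Matrix.mulVec_mulVec, B_mul_B lam nu]
  have hA := off_shell Complex.I (fun nu => (Aop N nu).mulVecLin) (fun nu => (Bop N nu).mulVecLin)
    (by
      intro lam nu v hne
      have hne' : lam - nu ≠ 0 := sub_ne_zero.2 hne
      have h := congrArg (fun M => (lam - nu)⁻¹ • M.mulVec v) (A_mul_B (N := N) lam nu)
      simp only [Matrix.add_mulVec, Matrix.smul_mulVec, smul_smul, smul_add,
        ← Matrix.mulVec_mulVec, inv_mul_cancel₀ hne', one_smul] at h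
      simp only [Matrix.mulVecLin_apply, div_eq_inv_mul, h])
    hBB lam hinj (partialVec N lam) (fun z => (z + Complex.I / 2) ^ N)
    (fun nu => by rw [partialVec_empty]; exact A_vac nu)
    (fun k s hk => partialVec_insert N lam k s hk) Finset.univ nu fun j _ => hnu j
  have hD := off_shell (-Complex.I) (fun nu => (Dop N nu).mulVecLin)
    (fun nu => (Bop N nu).mulVecLin)
    (by
      intro lam nu v hne
      have hne' : lam - nu ≠ 0 := sub_ne_zero.2 hne
      have h := congrArg (fun M => (lam - nu)⁻¹ • M.mulVec v) (D_mul_B (N := N) lam nu)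
      simp only [Matrix.sub_mulVec, Matrix.smul_mulVec, smul_smul, smul_sub,
        ← Matrix.mulVec_mulVec, inv_mul_cancel₀ hne', one_smul] at h
      simp only [Matrix.mulVecLin_apply, div_eq_inv_mul, h, sub_neg_eq_add, mul_neg, neg_smul,
        ← sub_eq_add_neg])
    hBB lam hinj (partialVec N lam) (fun z => (z - Complex.I / 2) ^ N)
    (fun nu => by rw [partialVec_empty]; exact D_vac nu)
    (fun k s hk => partialVec_insert N lam k s hk) Finset.univ nu fun j _ => hnu j
  have hflip : ∀ a b : ℂ, (a - b - -Complex.I) / (a - b) = (b - a - Complex.I) / (b - a) := by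
    intro a b
    rw [← neg_div_neg_eq]
    congr 1 <;> ring
  simp only [Matrix.mulVecLin_apply, hflip] at hA hD
  rw [tau, Matrix.add_mulVec, hA, hD, Lam, add_smul, add_add_add_comm, ← Finset.sum_add_distrib]
  congr 1
  refine Finset.sum_congr rfl fun k _ => ?_
  rw [← add_smul, LamK]
  congr 1
  ring

theorem differentiable_Bop (N : ℕ) (x y : St N) : Differentiable ℂ fun lam => Bop N lam x y := by
  intro z
  have h := hasDerivAt_prod (fun k => loc z (x k) (y k))
    (fun k => (if x k = y k then (1 : ℂ) else 0) • 1) z 0 1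
  simp only [← loc_eq_add] at h
  simp only [Bop, Matrix.of_apply, monodromy_apply]
  exact h.differentiableAt

theorem continuous_Bop (N : ℕ) : Continuous (Bop N) :=
  continuous_matrix fun x y => (differentiable_Bop N x y).continuous

theorem tendsto_Bop_mul_Bop (N : ℕ) (hN : N ≠ 0) (c : ℂ) :
    ∃ G, Tendsto (fun eps : ℂ => (eps ^ N)⁻¹ • (Bop N (nwLam1 N c eps) * Bop N (nwLam2 eps)))
      (𝓝[≠] 0) (𝓝 G) := by
  obtain ⟨F, hF, hBF⟩ := exists_B_mul_B_eq N
  have h1 : Tendsto (fun eps : ℂ => nwLam1 N c eps) (𝓝[≠] 0) (𝓝 (Complex.I / 2)) := by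
    refine tendsto_nhdsWithin_of_tendsto_nhds (Continuous.tendsto' ?_ _ _ ?_)
    · unfold nwLam1; fun_prop
    · simp [nwLam1, hN]
  have h2 : Tendsto (fun eps : ℂ => Complex.I / 2 + eps) (𝓝[≠] 0) (𝓝 (Complex.I / 2)) := by
    refine tendsto_nhdsWithin_of_tendsto_nhds (Continuous.tendsto' ?_ _ _ ?_)
    · fun_prop
    · simp
  have hdiff : Tendsto (fun eps : ℂ => (eps ^ N)⁻¹ •
      (Bop N (nwLam1 N c eps) - Bop N (Complex.I / 2 + eps))) (𝓝[≠] 0)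
      (𝓝 (Matrix.of fun x y => c * deriv (fun lam => Bop N lam x y) (Complex.I / 2))) := by
    refine tendsto_pi_nhds.2 fun x => tendsto_pi_nhds.2 fun y => ?_
    have hs := ((differentiable_Bop N x y).contDiff (n := 1)).contDiffAt.hasStrictDerivAt
      (x := Complex.I / 2) one_ne_zero
    have ho := hs.isLittleO.comp_tendsto (h1.prodMk_nhds h2)
    have hsub : ∀ eps : ℂ, nwLam1 N c eps - (Complex.I / 2 + eps) = c * eps ^ N := by
      intro eps; simp [nwLam1]
    simp only [Function.comp_def, hsub] at ho
    have ho' := (ho.trans_isBigO (Asymptotics.isBigO_const_mul_self c _ _)).tendsto_div_nhds_zero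
    rw [← zero_add (Matrix.of _ x y)]
    refine (ho'.add_const _).congr' ?_
    filter_upwards [self_mem_nhdsWithin] with eps heps
    have : eps ^ N ≠ 0 := pow_ne_zero _ heps
    simp
    field_simp
    ring
  refine ⟨_, ((hF.tendsto 0).mono_left nhdsWithin_le_nhds |>.add (hdiff.mul
    (((continuous_Bop N).comp (f := nwLam2) (by unfold nwLam2; fun_prop)).tendsto 0 |>.mono_left
      nhdsWithin_le_nhds))).congr' ?_⟩
  filter_upwards [self_mem_nhdsWithin] with eps heps
  have : eps ^ N ≠ 0 := pow_ne_zero _ heps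
  have h3 : F eps = (eps ^ N)⁻¹ • (Bop N (Complex.I / 2 + eps) * Bop N (nwLam2 eps)) := by
    rw [nwLam2, hBF, smul_smul, inv_mul_cancel₀ this, one_smul]
  rw [h3, Function.comp_apply, smul_mul_assoc, ← smul_add, sub_mul, add_sub_cancel]

theorem continuous_partialVec (N : ℕ) {ι : Type*} (lam : ℂ → ι → ℂ) (hlam : Continuous lam)
    (s : Finset ι) : Continuous fun eps => partialVec N (lam eps) s := by
  classical
  induction s using Finset.induction_on with
  | empty => simp only [partialVec_empty]; exact continuous_const
  | insert k s hk ih =>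
    simp only [partialVec_insert N _ k s hk]
    exact ((continuous_Bop N).comp ((continuous_apply k).comp hlam)).matrix_mulVec ih

theorem continuous_nwTuple (N : ℕ) (c : ℂ) {m : ℕ} (mu : Fin m → ℂ) :
    Continuous (nwTuple N c mu) := by
  refine continuous_pi fun j => ?_
  refine Fin.cases ?_ (fun j => Fin.cases ?_ (fun j => ?_) j) j
  · simp only [nwTuple, Fin.cons_zero, nwLam1]; fun_prop
  · simp only [nwTuple, Fin.cons_zero, Fin.cons_succ, nwLam2]; fun_prop
  · simp only [nwTuple, Fin.cons_succ]; fun_prop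

theorem nwTuple_zero (N : ℕ) (hN : N ≠ 0) (c : ℂ) {m : ℕ} (mu : Fin m → ℂ) :
    nwTuple N c mu 0 = singTuple mu := by
  simp [nwTuple, singTuple, nwLam1, nwLam2, hN]

theorem tendsto_partialVec_nwTuple (N : ℕ) (hN : N ≠ 0) (c : ℂ) {m : ℕ} (mu : Fin m → ℂ)
    (s : Finset (Fin (m + 2))) (h0 : 0 ∈ s) (h1 : 1 ∈ s) :
    ∃ v, Tendsto (fun eps : ℂ => (eps ^ N)⁻¹ • partialVec N (nwTuple N c mu eps) s)
      (𝓝[≠] 0) (𝓝 v) := by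
  obtain ⟨G, hG⟩ := tendsto_Bop_mul_Bop N hN c
  have hs : s = insert 0 (insert 1 ((s.erase 0).erase 1)) := by
    rw [Finset.insert_erase (by simp [h1]), Finset.insert_erase h0]
  have hc := ((continuous_partialVec N _ (continuous_nwTuple N c mu) ((s.erase 0).erase 1)).tendsto
    0).mono_left (nhdsWithin_le_nhds (s := {0}ᶜ))
  refine ⟨_, (((continuous_fst.matrix_mulVec continuous_snd).tendsto (G, _)).comp
    (hG.prodMk_nhds hc)).congr fun eps => ?_⟩
  conv_rhs => rw [hs]
  rw [partialVec_insert _ _ _ _ (by simp), partialVec_insert _ _ _ _ (by simp),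
    Matrix.mulVec_mulVec]
  simp [Matrix.smul_mulVec, nwTuple]

theorem continuousAt_Lam (N : ℕ) {l : ℕ} (nu : ℂ) (x : Fin l → ℂ) (hnu : ∀ j, nu ≠ x j) :
    ContinuousAt (Lam N nu) x := by
  have he : ∀ j, ContinuousAt (fun y : Fin l → ℂ => y j) x := fun j =>
    (continuous_apply j).continuousAt
  exact (continuousAt_const.mul (tendsto_finsetProd _ fun j _ =>
      ((continuousAt_const.sub (he j)).sub continuousAt_const).div (continuousAt_const.sub (he j))
        (sub_ne_zero.2 (hnu j)))).add
    (continuousAt_const.mul (tendsto_finsetProd _ fun j _ =>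
      (((he j).sub continuousAt_const).sub continuousAt_const).div ((he j).sub continuousAt_const)
        (sub_ne_zero.2 (hnu j).symm)))

theorem continuousAt_LamK (N : ℕ) {l : ℕ} (nu : ℂ) (x : Fin l → ℂ) (hinj : Function.Injective x)
    (hnu : ∀ j, nu ≠ x j) (k : Fin l) : ContinuousAt (fun x => LamK N nu x k) x := by
  have he : ∀ j, ContinuousAt (fun y : Fin l → ℂ => y j) x := fun j =>
    (continuous_apply j).continuousAt
  have hne : ∀ j ∈ Finset.univ.erase k, x j ≠ x k := fun j hj h =>
    Finset.ne_of_mem_erase hj (hinj h)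
  exact (continuousAt_const.div (continuousAt_const.sub (he k)) (sub_ne_zero.2 (hnu k))).mul
    (((((he k).add continuousAt_const).pow N).mul (tendsto_finsetProd _ fun j hj =>
      (((he k).sub (he j)).sub continuousAt_const).div ((he k).sub (he j))
        (sub_ne_zero.2 (hne j hj).symm))).sub
    ((((he k).sub continuousAt_const).pow N).mul (tendsto_finsetProd _ fun j hj =>
      (((he j).sub (he k)).sub continuousAt_const).div ((he j).sub (he k))
        (sub_ne_zero.2 (hne j hj)))))

theorem singTuple_injective {m : ℕ} (mu : Fin m → ℂ) (hinj : Function.Injective mu)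
    (hp : ∀ j, mu j ≠ Complex.I / 2) (hm : ∀ j, mu j ≠ -(Complex.I / 2)) :
    Function.Injective (singTuple mu) := by
  refine Fin.cons_injective_iff.2 ⟨?_, Fin.cons_injective_iff.2 ⟨?_, hinj⟩⟩
  · rintro ⟨j, hj⟩
    refine Fin.cases (fun hj => ?_) (fun j hj => hp j hj) j hj
    have h2 : -(Complex.I / 2) = Complex.I / 2 := hj
    exact Complex.I_ne_zero (by linear_combination -h2)
  · rintro ⟨j, hj⟩
    exact hm j hj

theorem eventually_nwTuple_injective (N : ℕ) (hN : N ≠ 0) (c : ℂ) {m : ℕ} (mu : Fin m → ℂ)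
    (h : Function.Injective (singTuple mu)) :
    ∀ᶠ eps in 𝓝 (0 : ℂ), Function.Injective (nwTuple N c mu eps) := by
  have hc := fun i => (continuous_apply i).comp (continuous_nwTuple N c mu)
  have h1 : ∀ᶠ eps in 𝓝 (0 : ℂ), ∀ i j, i ≠ j → nwTuple N c mu eps i ≠ nwTuple N c mu eps j := by
    simp only [eventually_all]
    intro i j hij
    refine ((hc i).continuousAt.ne_iff_eventually_ne (hc j).continuousAt).1 ?_
    simpa [nwTuple_zero N hN] using h.ne hij
  filter_upwards [h1] with eps heps i j hij
  by_contra hne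
  exact heps i j hne hij

theorem eventually_ne_nwTuple (N : ℕ) (hN : N ≠ 0) (c : ℂ) {m : ℕ} (mu : Fin m → ℂ) (nu : ℂ)
    (h : ∀ j, nu ≠ singTuple mu j) :
    ∀ᶠ eps in 𝓝 (0 : ℂ), ∀ j, nu ≠ nwTuple N c mu eps j := by
  refine eventually_all.2 fun j => ?_
  have hc := ((continuous_apply j).comp (continuous_nwTuple N c mu)).continuousAt (x := 0)
  refine (hc.eventually_ne ?_).mono fun _ h => h.symm
  simpa [nwTuple_zero N hN] using (h j).symm

theorem LamK_singTuple (N : ℕ) {m : ℕ} (mu : Fin m → ℂ) (nu : ℂ)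
    (hp : ∀ j, mu j ≠ Complex.I / 2) (h3p : ∀ j, mu j ≠ 3 * Complex.I / 2)
    (hstr : ∀ j k : Fin m, j ≠ k → mu k - mu j ≠ Complex.I) (k : Fin m)
    (hBAE : ((mu k + Complex.I / 2) / (mu k - Complex.I / 2)) ^ N =
        ∏ j ∈ Finset.univ.erase (k.succ.succ : Fin (m + 2)),
          (mu k - singTuple mu j + Complex.I) /
            (mu k - singTuple mu j - Complex.I)) :
    LamK N nu (singTuple mu) k.succ.succ = 0 := by
  have hk : singTuple mu k.succ.succ = mu k := rfl
  have hne : ∀ j ∈ Finset.univ.erase (k.succ.succ : Fin (m + 2)),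
      mu k - singTuple mu j - Complex.I ≠ 0 := by
    intro j
    refine Fin.cases (fun _ h => ?_) (fun j => Fin.cases (fun _ h => ?_) (fun j hj h => ?_) j) j
    · have h' : mu k - Complex.I / 2 - Complex.I = 0 := h
      exact h3p k (by linear_combination h')
    · have h' : mu k - -(Complex.I / 2) - Complex.I = 0 := h
      exact hp k (by linear_combination h')
    · have h' : mu k - mu j - Complex.I = 0 := h
      refine hstr j k ?_ (by linear_combination h')
      rintro rfl
      simp at hj
  have hflip : ∀ j, (singTuple mu j - mu k - Complex.I) / (singTuple mu j - mu k) =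
      (mu k - singTuple mu j + Complex.I) / (mu k - singTuple mu j) := by
    intro j
    rw [← neg_div_neg_eq]
    congr 1 <;> ring
  have h1 : mu k - Complex.I / 2 ≠ 0 := sub_ne_zero.2 (hp k)
  rw [div_pow, Finset.prod_div_distrib, div_eq_div_iff (pow_ne_zero _ h1)
    (Finset.prod_ne_zero_iff.2 hne)] at hBAE
  rw [LamK, hk]
  simp only [hflip, Finset.prod_div_distrib]
  rw [mul_div_assoc', hBAE]
  ring

theorem prod_univ_erase_zero {m : ℕ} (f : Fin (m + 2) → ℂ) :
    ∏ j ∈ Finset.univ.erase 0, f j = f 1 * ∏ j : Fin m, f j.succ.succ := by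
  rw [Fin.univ_succ, Finset.erase_cons, Finset.prod_map, Fin.prod_univ_succ]
  rfl

theorem prod_univ_erase_one {m : ℕ} (f : Fin (m + 2) → ℂ) :
    ∏ j ∈ Finset.univ.erase 1, f j = f 0 * ∏ j : Fin m, f j.succ.succ := by
  rw [Fin.univ_succ, Finset.erase_cons_of_ne _ (by simp), Finset.prod_cons, Fin.univ_succ,
    show (1 : Fin (m + 2)) = (⟨Fin.succ, Fin.succ_injective _⟩ : Fin (m + 1) ↪ Fin (m + 2)) 0
      from rfl, ← Finset.map_erase, Finset.erase_cons]
  simp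

theorem tendsto_LamK_nwTuple_zero (N : ℕ) (hN : 2 ≤ N) {m : ℕ} (mu : Fin m → ℂ)
    (hp : ∀ j, mu j ≠ Complex.I / 2) (hm : ∀ j, mu j ≠ -(Complex.I / 2)) (c : ℂ)
    (hc : c = -(2 / Complex.I ^ (N + 1)) *
      ∏ j, (mu j - 3 * Complex.I / 2) / (mu j + Complex.I / 2))
    (nu : ℂ) (hnu : nu ≠ Complex.I / 2) :
    Tendsto (fun eps : ℂ => (eps ^ N)⁻¹ * LamK N nu (nwTuple N c mu eps) 0) (𝓝[≠] 0) (𝓝 0) := by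
  obtain ⟨n, rfl⟩ := Nat.exists_eq_add_of_le' hN
  have hx0 : nwLam1 (n + 2) c 0 = Complex.I / 2 := by simp [nwLam1]
  have hx : ContinuousAt (nwLam1 (n + 2) c) 0 := by unfold nwLam1; fun_prop
  have hd : ContinuousAt (fun eps : ℂ => Complex.I + c * eps ^ (n + 2)) 0 := by fun_prop
  have hd0 : Complex.I + c * 0 ^ (n + 2) ≠ 0 := by simp
  have hne : ∀ j, nwLam1 (n + 2) c 0 - mu j ≠ 0 := fun j => by
    rw [hx0]; exact sub_ne_zero.2 (hp j).symm
  have hne' : ∀ j, mu j - nwLam1 (n + 2) c 0 ≠ 0 := fun j => by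
    rw [hx0]; exact sub_ne_zero.2 (hp j)
  have hg : ContinuousAt (fun eps => Complex.I / (nu - nwLam1 (n + 2) c eps) *
      ((nwLam1 (n + 2) c eps + Complex.I / 2) ^ (n + 2) *
        (c / (Complex.I + c * eps ^ (n + 2)) *
          ∏ j, (nwLam1 (n + 2) c eps - mu j - Complex.I) / (nwLam1 (n + 2) c eps - mu j)) -
      (1 + c * eps ^ (n + 1)) ^ (n + 2) *
        ((2 * Complex.I + c * eps ^ (n + 2)) / (Complex.I + c * eps ^ (n + 2)) *
          ∏ j, (mu j - nwLam1 (n + 2) c eps - Complex.I) /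
            (mu j - nwLam1 (n + 2) c eps)))) 0 := by
    refine (continuousAt_const.div (continuousAt_const.sub hx)
      (sub_ne_zero.2 (by rwa [hx0]))).mul
      ((((hx.add continuousAt_const).pow _).mul ((continuousAt_const.div hd hd0).mul
        (tendsto_finsetProd _ fun j _ =>
          ((hx.sub continuousAt_const).sub continuousAt_const).div (hx.sub continuousAt_const)
            (hne j)))).sub
      (ContinuousAt.mul (by fun_prop) ((ContinuousAt.div (by fun_prop) hd hd0).mul
        (tendsto_finsetProd _ fun j _ =>
          ((continuousAt_const.sub hx).sub continuousAt_const).div (continuousAt_const.sub hx)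
            (hne' j)))))
  have hg' := hg.tendsto.mono_left (nhdsWithin_le_nhds (s := {0}ᶜ))
  have hprod : ∏ j, (Complex.I / 2 - mu j - Complex.I) / (Complex.I / 2 - mu j) =
      ∏ j, (mu j + Complex.I / 2) / (mu j - Complex.I / 2) := by
    refine Finset.prod_congr rfl fun j _ => ?_
    rw [← neg_div_neg_eq]
    congr 1 <;> ring
  have hprod' : ∏ j, (mu j - Complex.I / 2 - Complex.I) / (mu j - Complex.I / 2) =
      ∏ j, (mu j - 3 * Complex.I / 2) / (mu j - Complex.I / 2) := by
    refine Finset.prod_congr rfl fun j _ => ?_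
    congr 1; ring
  have hPm : ∏ j, (mu j - Complex.I / 2) ≠ 0 :=
    Finset.prod_ne_zero_iff.2 fun j _ => sub_ne_zero.2 (hp j)
  have hPp : ∏ j, (mu j + Complex.I / 2) ≠ 0 :=
    Finset.prod_ne_zero_iff.2 fun j _ => fun h => hm j (eq_neg_of_add_eq_zero_left h)
  have hzero : Complex.I ^ (n + 2) * (c / Complex.I *
      ∏ j, (mu j + Complex.I / 2) / (mu j - Complex.I / 2)) -
      2 * ∏ j, (mu j - 3 * Complex.I / 2) / (mu j - Complex.I / 2) = 0 := by
    rw [hc]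
    simp only [Finset.prod_div_distrib]
    generalize ∏ j, (mu j - Complex.I / 2) = Pm at *
    generalize ∏ j, (mu j + Complex.I / 2) = Pp at *
    generalize ∏ j, (mu j - 3 * Complex.I / 2) = P3 at *
    have hI := Complex.I_ne_zero
    field_simp
    linear_combination (-2) * P3 * Complex.I ^ (n + 2) * Complex.I_sq
  have hval : Complex.I / (nu - nwLam1 (n + 2) c 0) *
      ((nwLam1 (n + 2) c 0 + Complex.I / 2) ^ (n + 2) *
        (c / (Complex.I + c * 0 ^ (n + 2)) *
          ∏ j, (nwLam1 (n + 2) c 0 - mu j - Complex.I) / (nwLam1 (n + 2) c 0 - mu j)) -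
      (1 + c * 0 ^ (n + 1)) ^ (n + 2) *
        ((2 * Complex.I + c * 0 ^ (n + 2)) / (Complex.I + c * 0 ^ (n + 2)) *
          ∏ j, (mu j - nwLam1 (n + 2) c 0 - Complex.I) /
            (mu j - nwLam1 (n + 2) c 0))) = 0 := by
    rw [hx0, hprod, hprod', add_halves]
    simp only [ne_eq, Nat.add_eq_zero_iff, one_ne_zero, OfNat.ofNat_ne_zero, and_false,
      not_false_eq_true, zero_pow, mul_zero, add_zero, one_pow, one_mul]
    rw [mul_div_cancel_right₀ _ Complex.I_ne_zero, hzero, mul_zero]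
  rw [hval] at hg'
  refine hg'.congr' ?_
  filter_upwards [self_mem_nhdsWithin] with eps heps
  have heps0 : eps ^ (n + 2) ≠ 0 := pow_ne_zero _ heps
  have e1 : nwLam1 (n + 2) c eps - nwLam2 eps = Complex.I + c * eps ^ (n + 2) := by
    rw [nwLam1, nwLam2]; ring
  have e2 : nwLam1 (n + 2) c eps - Complex.I / 2 = eps * (1 + c * eps ^ (n + 1)) := by
    rw [nwLam1]; ring
  have e3 : (nwLam2 eps - nwLam1 (n + 2) c eps - Complex.I) /
      (nwLam2 eps - nwLam1 (n + 2) c eps) =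
      (2 * Complex.I + c * eps ^ (n + 2)) / (Complex.I + c * eps ^ (n + 2)) := by
    rw [← neg_sub (nwLam1 _ _ _), e1, ← neg_div_neg_eq]
    congr 1 <;> ring
  simp only [LamK, prod_univ_erase_zero]
  change _ = (eps ^ (n + 2))⁻¹ * (Complex.I / (nu - nwLam1 (n + 2) c eps) *
    ((nwLam1 (n + 2) c eps + Complex.I / 2) ^ (n + 2) *
      ((nwLam1 (n + 2) c eps - nwLam2 eps - Complex.I) / (nwLam1 (n + 2) c eps - nwLam2 eps) *
        ∏ j, (nwLam1 (n + 2) c eps - mu j - Complex.I) / (nwLam1 (n + 2) c eps - mu j)) -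
      (nwLam1 (n + 2) c eps - Complex.I / 2) ^ (n + 2) *
        ((nwLam2 eps - nwLam1 (n + 2) c eps - Complex.I) /
          (nwLam2 eps - nwLam1 (n + 2) c eps) *
        ∏ j, (mu j - nwLam1 (n + 2) c eps - Complex.I) / (mu j - nwLam1 (n + 2) c eps))))
  rw [e1, e2, e3, mul_pow, add_sub_cancel_left]
  generalize ∏ j, (nwLam1 (n + 2) c eps - mu j - Complex.I) / (nwLam1 (n + 2) c eps - mu j) = P
  generalize ∏ j, (mu j - nwLam1 (n + 2) c eps - Complex.I) / (mu j - nwLam1 (n + 2) c eps) = Q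
  field_simp

theorem tendsto_LamK_nwTuple_one (N : ℕ) (hN : N ≠ 0) {m : ℕ} (mu : Fin m → ℂ)
    (hp : ∀ j, mu j ≠ Complex.I / 2) (hm : ∀ j, mu j ≠ -(Complex.I / 2)) (c : ℂ)
    (hc : c = 2 * Complex.I ^ (N + 1) *
      ∏ j, (mu j + 3 * Complex.I / 2) / (mu j - Complex.I / 2))
    (nu : ℂ) (hnu : nu ≠ -(Complex.I / 2)) :
    Tendsto (fun eps : ℂ => (eps ^ N)⁻¹ * LamK N nu (nwTuple N c mu eps) 1) (𝓝[≠] 0) (𝓝 0) := by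
  have hx0 : nwLam2 0 = -(Complex.I / 2) := by simp [nwLam2]
  have hx : ContinuousAt nwLam2 0 := by unfold nwLam2; fun_prop
  have hd : ContinuousAt (fun eps : ℂ => Complex.I + c * eps ^ N) 0 := by fun_prop
  have hd0 : Complex.I + c * 0 ^ N ≠ 0 := by simp [hN]
  have hne : ∀ j, nwLam2 0 - mu j ≠ 0 := fun j => by
    rw [hx0]; exact sub_ne_zero.2 (hm j).symm
  have hne' : ∀ j, mu j - nwLam2 0 ≠ 0 := fun j => by
    rw [hx0]; exact sub_ne_zero.2 (hm j)
  have hg : ContinuousAt (fun eps => Complex.I / (nu - nwLam2 eps) *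
      ((2 * Complex.I + c * eps ^ N) / (Complex.I + c * eps ^ N) *
          (∏ j, (nwLam2 eps - mu j - Complex.I) / (nwLam2 eps - mu j)) -
      (nwLam2 eps - Complex.I / 2) ^ N * (c / (Complex.I + c * eps ^ N) *
          ∏ j, (mu j - nwLam2 eps - Complex.I) / (mu j - nwLam2 eps)))) 0 := by
    refine (continuousAt_const.div (continuousAt_const.sub hx)
      (sub_ne_zero.2 (by rwa [hx0]))).mul
      (((ContinuousAt.div (by fun_prop) hd hd0).mul
        (tendsto_finsetProd _ fun j _ =>
          ((hx.sub continuousAt_const).sub continuousAt_const).div (hx.sub continuousAt_const)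
            (hne j))).sub
      (((hx.sub continuousAt_const).pow _).mul ((continuousAt_const.div hd hd0).mul
        (tendsto_finsetProd _ fun j _ =>
          ((continuousAt_const.sub hx).sub continuousAt_const).div (continuousAt_const.sub hx)
            (hne' j)))))
  have hg' := hg.tendsto.mono_left (nhdsWithin_le_nhds (s := {0}ᶜ))
  have hprod : ∏ j, (-(Complex.I / 2) - mu j - Complex.I) / (-(Complex.I / 2) - mu j) =
      ∏ j, (mu j + 3 * Complex.I / 2) / (mu j + Complex.I / 2) := by
    refine Finset.prod_congr rfl fun j _ => ?_
    rw [← neg_div_neg_eq]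
    congr 1 <;> ring
  have hprod' : ∏ j, (mu j - -(Complex.I / 2) - Complex.I) / (mu j - -(Complex.I / 2)) =
      ∏ j, (mu j - Complex.I / 2) / (mu j + Complex.I / 2) := by
    refine Finset.prod_congr rfl fun j _ => ?_
    congr 1 <;> ring
  have hPm : ∏ j, (mu j - Complex.I / 2) ≠ 0 :=
    Finset.prod_ne_zero_iff.2 fun j _ => sub_ne_zero.2 (hp j)
  have hPp : ∏ j, (mu j + Complex.I / 2) ≠ 0 :=
    Finset.prod_ne_zero_iff.2 fun j _ => fun h => hm j (eq_neg_of_add_eq_zero_left h)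
  have hzero : 2 * ∏ j, (mu j + 3 * Complex.I / 2) / (mu j + Complex.I / 2) -
      (-Complex.I) ^ N * (c / Complex.I *
        ∏ j, (mu j - Complex.I / 2) / (mu j + Complex.I / 2)) = 0 := by
    rw [hc]
    simp only [Finset.prod_div_distrib]
    generalize ∏ j, (mu j - Complex.I / 2) = Pm at *
    generalize ∏ j, (mu j + Complex.I / 2) = Pp at *
    generalize ∏ j, (mu j + 3 * Complex.I / 2) = P3 at *
    have hI : (-Complex.I) ^ N * Complex.I ^ N = 1 := by
      rw [← mul_pow, neg_mul, Complex.I_mul_I, neg_neg, one_pow]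
    have hI0 := Complex.I_ne_zero
    rw [pow_succ]
    field_simp
    linear_combination (-2) * P3 * hI
  have hval : Complex.I / (nu - nwLam2 0) *
      ((2 * Complex.I + c * 0 ^ N) / (Complex.I + c * 0 ^ N) *
          (∏ j, (nwLam2 0 - mu j - Complex.I) / (nwLam2 0 - mu j)) -
      (nwLam2 0 - Complex.I / 2) ^ N * (c / (Complex.I + c * 0 ^ N) *
          ∏ j, (mu j - nwLam2 0 - Complex.I) / (mu j - nwLam2 0))) = 0 := by
    rw [hx0, hprod, hprod', ← neg_add', add_halves, zero_pow hN, mul_zero, add_zero, add_zero,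
      mul_div_cancel_right₀ _ Complex.I_ne_zero, hzero, mul_zero]
  rw [hval] at hg'
  refine hg'.congr' ?_
  filter_upwards [self_mem_nhdsWithin] with eps heps
  have heps0 : eps ^ N ≠ 0 := pow_ne_zero _ heps
  have e1 : nwLam1 N c eps - nwLam2 eps = Complex.I + c * eps ^ N := by
    rw [nwLam1, nwLam2]; ring
  have e2 : nwLam2 eps + Complex.I / 2 = eps := by
    rw [nwLam2]; ring
  have e3 : (nwLam2 eps - nwLam1 N c eps - Complex.I) / (nwLam2 eps - nwLam1 N c eps) =
      (2 * Complex.I + c * eps ^ N) / (Complex.I + c * eps ^ N) := by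
    rw [← neg_sub (nwLam1 _ _ _), e1, ← neg_div_neg_eq]
    congr 1 <;> ring
  simp only [LamK, prod_univ_erase_one]
  change _ = (eps ^ N)⁻¹ * (Complex.I / (nu - nwLam2 eps) *
    ((nwLam2 eps + Complex.I / 2) ^ N *
      ((nwLam2 eps - nwLam1 N c eps - Complex.I) / (nwLam2 eps - nwLam1 N c eps) *
        ∏ j, (nwLam2 eps - mu j - Complex.I) / (nwLam2 eps - mu j)) -
      (nwLam2 eps - Complex.I / 2) ^ N *
        ((nwLam1 N c eps - nwLam2 eps - Complex.I) / (nwLam1 N c eps - nwLam2 eps) *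
        ∏ j, (mu j - nwLam2 eps - Complex.I) / (mu j - nwLam2 eps))))
  rw [e1, e2, e3, add_sub_cancel_left]
  generalize ∏ j, (nwLam2 eps - mu j - Complex.I) / (nwLam2 eps - mu j) = P
  generalize ∏ j, (mu j - nwLam2 eps - Complex.I) / (mu j - nwLam2 eps) = Q
  field_simp

theorem tau_mulVec_of_tendsto (N : ℕ) (hN : 2 ≤ N) {m : ℕ} (mu : Fin m → ℂ)
    (hinj : Function.Injective mu)
    (hp : ∀ j, mu j ≠ Complex.I / 2) (hm : ∀ j, mu j ≠ -(Complex.I / 2))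
    (h3p : ∀ j, mu j ≠ 3 * Complex.I / 2)
    (hstr : ∀ j k : Fin m, j ≠ k → mu k - mu j ≠ Complex.I)
    (hBAE : ∀ k : Fin m,
      ((mu k + Complex.I / 2) / (mu k - Complex.I / 2)) ^ N =
        ∏ j ∈ Finset.univ.erase (k.succ.succ : Fin (m + 2)),
          (mu k - singTuple mu j + Complex.I) /
            (mu k - singTuple mu j - Complex.I))
    (c : ℂ)
    (hc1 : c = -(2 / Complex.I ^ (N + 1)) *
      ∏ j, (mu j - 3 * Complex.I / 2) / (mu j + Complex.I / 2))
    (hc2 : c = 2 * Complex.I ^ (N + 1) *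
      ∏ j, (mu j + 3 * Complex.I / 2) / (mu j - Complex.I / 2))
    (Ψ : St N → ℂ)
    (hΨ : Tendsto (fun eps : ℂ => (eps ^ N)⁻¹ • partialVec N (nwTuple N c mu eps) Finset.univ)
      (𝓝[≠] 0) (𝓝 Ψ))
    (nu : ℂ) (hnu : ∀ j, nu ≠ singTuple mu j) :
    (tau N nu).mulVec Ψ = Lam N nu (singTuple mu) • Ψ := by
  have hN0 : N ≠ 0 := by omega
  have hsing := singTuple_injective mu hinj hp hm
  have hcont := fun s => continuous_partialVec N _ (continuous_nwTuple N c mu) s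
  have hle : 𝓝[≠] (0 : ℂ) ≤ 𝓝 0 := nhdsWithin_le_nhds
  have hmulVec : ∀ M : Matrix (St N) (St N) ℂ, Continuous M.mulVec := fun M =>
    continuous_const.matrix_mulVec continuous_id
  have htuple : Tendsto (nwTuple N c mu) (𝓝[≠] 0) (𝓝 (singTuple mu)) := by
    rw [← nwTuple_zero N hN0 c mu]
    exact ((continuous_nwTuple N c mu).tendsto 0).mono_left hle
  have hunwanted : ∀ k, Tendsto (fun eps : ℂ => (eps ^ N)⁻¹ • LamK N nu (nwTuple N c mu eps) k •
      (Bop N nu).mulVec (partialVec N (nwTuple N c mu eps) (Finset.univ.erase k)))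
      (𝓝[≠] 0) (𝓝 0) := by
    have hsmall : ∀ k, Tendsto (fun eps : ℂ => (eps ^ N)⁻¹ * LamK N nu (nwTuple N c mu eps) k)
        (𝓝[≠] 0) (𝓝 0) → Tendsto (fun eps : ℂ => (eps ^ N)⁻¹ • LamK N nu (nwTuple N c mu eps) k •
      (Bop N nu).mulVec (partialVec N (nwTuple N c mu eps) (Finset.univ.erase k)))
      (𝓝[≠] 0) (𝓝 0) := by
      intro k hk
      have h := hk.smul ((((hmulVec (Bop N nu)).comp (hcont (Finset.univ.erase k))).tendsto
        0).mono_left hle)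
      rw [zero_smul] at h
      exact h.congr fun eps => mul_smul _ _ _
    intro k
    refine Fin.cases ?_ (fun k => Fin.cases ?_ (fun k => ?_) k) k
    · exact hsmall 0 (tendsto_LamK_nwTuple_zero N hN mu hp hm c hc1 nu (hnu 0))
    · exact hsmall 1 (tendsto_LamK_nwTuple_one N hN0 mu hp hm c hc2 nu (hnu 1))
    · obtain ⟨v, hv⟩ := tendsto_partialVec_nwTuple N hN0 c mu (Finset.univ.erase k.succ.succ)
        (Finset.mem_erase.2 ⟨(Fin.succ_ne_zero _).symm, Finset.mem_univ _⟩)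
        (Finset.mem_erase.2 ⟨fun h => (Fin.succ_ne_zero k).symm (Fin.succ_injective _ h),
          Finset.mem_univ _⟩)
      have hL := (continuousAt_LamK N nu _ hsing hnu k.succ.succ).tendsto.comp htuple
      rw [LamK_singTuple N mu nu hp h3p hstr k (hBAE k)] at hL
      have h := hL.smul (((hmulVec (Bop N nu)).tendsto v).comp hv)
      rw [zero_smul] at h
      refine h.congr fun eps => ?_
      rw [Function.comp_apply, Function.comp_apply, Matrix.mulVec_smul, smul_comm]
  have hlhs := ((hmulVec (tau N nu)).tendsto Ψ).comp hΨ
  have hrhs := (((continuousAt_Lam N nu _ hnu).tendsto.comp htuple).smul hΨ).add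
    (tendsto_finsetSum Finset.univ fun k _ => hunwanted k)
  rw [Finset.sum_const_zero, add_zero] at hrhs
  refine tendsto_nhds_unique hlhs (hrhs.congr' ?_)
  filter_upwards [hle (eventually_nwTuple_injective N hN0 c mu hsing),
    hle (eventually_ne_nwTuple N hN0 c mu nu hnu)] with eps h1 h2
  rw [Function.comp_apply, Function.comp_apply, Matrix.mulVec_smul,
    tau_mulVec_partialVec N _ h1 nu h2, smul_add, smul_comm, Finset.smul_sum]

theorem hasDerivAt_finsetProd_of_logDeriv {ι : Type*} (s : Finset ι) (g : ι → ℂ → ℂ) (r : ι → ℂ)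
    (x : ℂ) (h : ∀ j ∈ s, HasDerivAt (g j) (g j x * r j) x) :
    HasDerivAt (fun z => ∏ j ∈ s, g j z) ((∏ j ∈ s, g j x) * ∑ j ∈ s, r j) x := by
  classical
  induction s using Finset.induction_on with
  | empty => simpa using hasDerivAt_const x (1 : ℂ)
  | insert k s hk ih =>
    simp only [Finset.prod_insert hk, Finset.sum_insert hk]
    refine ((h k (Finset.mem_insert_self k s)).fun_mul
      (ih fun j hj => h j (Finset.mem_insert_of_mem hj))).congr_deriv ?_
    ring

/-- The eigenvalue of the transfer matrix for the singular tuple, with the removable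
singularities at `± I / 2` cancelled. -/
def singEigenvalue (n : ℕ) {m : ℕ} (mu : Fin m → ℂ) (lam : ℂ) : ℂ :=
  (lam + Complex.I / 2) ^ (n + 2) * (lam - 3 * Complex.I / 2) *
      ∏ j, (lam - mu j - Complex.I) / (lam - mu j) +
    (lam - Complex.I / 2) ^ (n + 2) * ((lam + 3 * Complex.I / 2) *
      ∏ j, (mu j - lam - Complex.I) / (mu j - lam))

theorem Lam_singTuple (n : ℕ) {m : ℕ} (mu : Fin m → ℂ) (lam : ℂ) (h1 : lam ≠ Complex.I / 2)
    (h2 : lam ≠ -(Complex.I / 2)) :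
    Lam (n + 3) lam (singTuple mu) = singEigenvalue n mu lam := by
  have e1 : lam - Complex.I / 2 ≠ 0 := sub_ne_zero.2 h1
  have e2 : lam - -(Complex.I / 2) ≠ 0 := sub_ne_zero.2 h2
  have e3 : Complex.I / 2 - lam ≠ 0 := sub_ne_zero.2 h1.symm
  have e4 : -(Complex.I / 2) - lam ≠ 0 := sub_ne_zero.2 h2.symm
  rw [Lam, singEigenvalue]
  simp only [Fin.prod_univ_succ]
  simp only [singTuple, Fin.cons_zero, Fin.cons_succ]
  have key : ∀ a b d : ℂ, b ≠ 0 → d ≠ 0 → a / b * (b / d) * d = a := by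
    intro a b d hb hd
    field_simp
  have f1 : (lam - Complex.I / 2 - Complex.I) / (lam - Complex.I / 2) *
      ((lam - -(Complex.I / 2) - Complex.I) / (lam - -(Complex.I / 2))) *
      (lam + Complex.I / 2) = lam - 3 * Complex.I / 2 := by
    have h := key (lam - Complex.I / 2 - Complex.I) _ _ e1 e2
    rw [show lam - -(Complex.I / 2) - Complex.I = lam - Complex.I / 2 by ring]
    linear_combination h
  have f2 : (Complex.I / 2 - lam - Complex.I) / (Complex.I / 2 - lam) *
      ((-(Complex.I / 2) - lam - Complex.I) / (-(Complex.I / 2) - lam)) *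
      (lam - Complex.I / 2) = lam + 3 * Complex.I / 2 := by
    have h := key (-(Complex.I / 2) - lam - Complex.I) _ _ e4 e3
    rw [show Complex.I / 2 - lam - Complex.I = -(Complex.I / 2) - lam by ring]
    linear_combination -h
  rw [← f1, ← f2]
  ring

theorem hasDerivAt_singEigenvalue (n : ℕ) {m : ℕ} (mu : Fin m → ℂ)
    (hp : ∀ j, mu j ≠ Complex.I / 2) (hm : ∀ j, mu j ≠ -(Complex.I / 2)) :
    HasDerivAt (singEigenvalue n mu) (singEigenvalue n mu (Complex.I / 2) *
      (-(Complex.I * (n + 1)) + ∑ j, Complex.I / (mu j ^ 2 + 1 / 4))) (Complex.I / 2) := by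
  have e1 : ∀ j, Complex.I / 2 - mu j ≠ 0 := fun j => sub_ne_zero.2 (hp j).symm
  have e2 : ∀ j, mu j - Complex.I / 2 ≠ 0 := fun j => sub_ne_zero.2 (hp j)
  have e3 : ∀ j, Complex.I / 2 - mu j - Complex.I ≠ 0 := fun j h =>
    hm j (by linear_combination -h)
  have e4 : ∀ j, mu j ^ 2 + 1 / 4 = (Complex.I / 2 - mu j) * (Complex.I / 2 - mu j - Complex.I) :=
    fun j => by linear_combination (1 / 4) * Complex.I_sq
  have hid := hasDerivAt_id (Complex.I / 2)
  have hprod := hasDerivAt_finsetProd_of_logDeriv Finset.univ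
    (fun j lam => (lam - mu j - Complex.I) / (lam - mu j))
    (fun j => Complex.I / (mu j ^ 2 + 1 / 4)) (Complex.I / 2) fun j _ => by
      refine (((hid.sub_const (mu j)).sub_const Complex.I).fun_div (hid.sub_const (mu j))
        (e1 j)).congr_deriv ?_
      have := e1 j
      have := e3 j
      simp only [id, e4]
      generalize Complex.I / 2 - mu j = a at *
      field_simp
      ring
  have hfirst := (((hid.add_const (Complex.I / 2)).fun_pow (n + 2)).fun_mul
    (hid.sub_const (3 * Complex.I / 2))).fun_mul hprod
  have hdiff : DifferentiableAt ℂ (fun lam : ℂ => (lam + 3 * Complex.I / 2) *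
      ∏ j, (mu j - lam - Complex.I) / (mu j - lam)) (Complex.I / 2) := by
    refine DifferentiableAt.fun_mul (by fun_prop) (DifferentiableAt.fun_finsetProd fun j _ => ?_)
    exact DifferentiableAt.fun_div (by fun_prop) (by fun_prop) (e2 j)
  have hsecond := ((hid.sub_const (Complex.I / 2)).fun_pow (n + 2)).fun_mul hdiff.hasDerivAt
  refine (hfirst.add hsecond).congr_deriv ?_
  simp only [singEigenvalue, id, add_halves, sub_self]
  generalize ∏ j, (Complex.I / 2 - mu j - Complex.I) / (Complex.I / 2 - mu j) = P
  generalize ∑ j, Complex.I / (mu j ^ 2 + 1 / 4) = S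
  simp only [Nat.add_succ_sub_one, zero_pow (Nat.succ_ne_zero _)]
  push_cast
  linear_combination (-(n + 1 : ℂ)) * P * Complex.I ^ (n + 2) * Complex.I_sq

theorem singEigenvalue_ne_zero (n : ℕ) {m : ℕ} (mu : Fin m → ℂ)
    (hp : ∀ j, mu j ≠ Complex.I / 2) (hm : ∀ j, mu j ≠ -(Complex.I / 2)) :
    singEigenvalue n mu (Complex.I / 2) ≠ 0 := by
  have h : ∏ j, (Complex.I / 2 - mu j - Complex.I) / (Complex.I / 2 - mu j) ≠ 0 :=
    Finset.prod_ne_zero_iff.2 fun j _ => div_ne_zero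
      (fun h => hm j (by linear_combination -h)) (sub_ne_zero.2 (hp j).symm)
  have h2 : Complex.I / 2 - 3 * Complex.I / 2 ≠ 0 := fun h2 =>
    Complex.I_ne_zero (by linear_combination -h2)
  rw [singEigenvalue, sub_self, add_halves, zero_pow (by omega), zero_mul, add_zero]
  exact mul_ne_zero (mul_ne_zero (pow_ne_zero _ Complex.I_ne_zero) h2) h

/-- The Nepomechie–Wang state has energy eigenvalue
`ℰ = −J − (J/2) Σ_{j=3}^{ℓ} 1/(λⱼ² + 1/4)`. -/
theorem nw_state_energy (N : ℕ) (hN : 3 ≤ N) (J : ℝ) {m : ℕ}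
    (mu : Fin m → ℂ)
    (hinj : Function.Injective mu)
    (hp : ∀ j, mu j ≠ Complex.I / 2) (hm : ∀ j, mu j ≠ -(Complex.I / 2))
    (h3p : ∀ j, mu j ≠ 3 * Complex.I / 2) (h3m : ∀ j, mu j ≠ -(3 * Complex.I / 2))
    (hstr : ∀ j k : Fin m, j ≠ k → mu k - mu j ≠ Complex.I)
    (hBAE : ∀ k : Fin m,
      ((mu k + Complex.I / 2) / (mu k - Complex.I / 2)) ^ N =
        ∏ j ∈ Finset.univ.erase (k.succ.succ : Fin (m + 2)),
          (mu k - singTuple mu j + Complex.I) /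
            (mu k - singTuple mu j - Complex.I))
    (c : ℂ)
    (hc1 : c = -(2 / Complex.I ^ (N + 1)) *
      ∏ j, (mu j - 3 * Complex.I / 2) / (mu j + Complex.I / 2))
    (hc2 : c = 2 * Complex.I ^ (N + 1) *
      ∏ j, (mu j + 3 * Complex.I / 2) / (mu j - Complex.I / 2)) :
    ∃ Ψ : St N → ℂ, Tendsto
      (fun eps : ℂ => (eps ^ N)⁻¹ •
        (Bop N (nwLam1 N c eps) * Bop N (nwLam2 eps) *
          ((List.finRange m).map fun j => Bop N (mu j)).prod).mulVec (vac N))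
      (𝓝[≠] (0 : ℂ)) (𝓝 Ψ) ∧
      (Ham N J).mulVec Ψ =
        (-(J : ℂ) - ((J : ℂ) / 2) * ∑ j, 1 / ((mu j) ^ 2 + 1 / 4)) • Ψ := by
  have hN0 : N ≠ 0 := by omega
  obtain ⟨Ψ, hΨ⟩ := tendsto_partialVec_nwTuple N hN0 c mu Finset.univ (Finset.mem_univ _)
    (Finset.mem_univ _)
  refine ⟨Ψ, ?_, ?_⟩
  · refine hΨ.congr fun eps => ?_
    rw [partialVec_univ, betheVec, betheProd]
    simp [List.finRange_succ, nwTuple, Function.comp_def, mul_assoc]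
  · obtain ⟨n, rfl⟩ := Nat.exists_eq_add_of_le' hN
    have heig : ∀ᶠ lam in 𝓝[≠] (Complex.I / 2),
        (tau (n + 3) lam).mulVec Ψ = singEigenvalue n mu lam • Ψ := by
      have hmu : ∀ᶠ lam in 𝓝 (Complex.I / 2), ∀ j, lam ≠ mu j :=
        eventually_all.2 fun j => eventually_ne_nhds (hp j).symm
      have hI : Complex.I / 2 ≠ -(Complex.I / 2) := fun h =>
        Complex.I_ne_zero (by linear_combination h)
      filter_upwards [self_mem_nhdsWithin, nhdsWithin_le_nhds (eventually_ne_nhds hI),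
        nhdsWithin_le_nhds hmu] with lam h1 h2 h3
      rw [← Lam_singTuple n mu lam h1 h2]
      refine tau_mulVec_of_tendsto (n + 3) (by omega) mu hinj hp hm h3p hstr hBAE c hc1 hc2 Ψ hΨ
        lam fun j => ?_
      exact Fin.cases h1 (fun j => Fin.cases h2 h3 j) j
    rw [Ham_mulVec_eq_of_tau (by omega) J Ψ _ _ heig (singEigenvalue_ne_zero n mu hp hm)
      (hasDerivAt_singEigenvalue n mu hp hm)]
    congr 1
    simp only [div_eq_mul_inv Complex.I, one_div, ← Finset.mul_sum]
    push_cast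
    linear_combination (J : ℂ) / 2 * (∑ j, (mu j ^ 2 + 4⁻¹)⁻¹ - (n + 1)) * Complex.I_sq
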